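/- Define y_f := Ŝ_n · Ê_f · Ĥ_f for 0 ≤ 2f ≤ n. Then y_0 · E_1 = Ŝ_n · E_1, and for 1 ≤ f ≤ ⌊n/2⌋ one has y_f · E_1 = ((rq^{2n−2f−2} − q⁻¹)(1 + qr⁻¹)/(q − q⁻¹)) · Ŝ_n · Ê_f · Ĥ_{f−1}^{{3,…,n}} + q^{2f} · Ŝ_n · Ê_{f+1} · Ĥ_f^{{3,…,n}}, where the second summand is interpreted as 0 when 2f + 2 > n (i.e. when f = ⌊n/2⌋), and Ĥ_g^{{3,…,n}} denotes the hat of the image of H_g(n−2) under the embedding of S_{n−2} into S_n as the permutations of {3,…,n}. -/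

import Mathlib

open Finset
open scoped Pointwise

namespace BMWPaper

/-- The Coxeter length of a permutation of `Fin n`: the number of inversions. -/
def len {n : ℕ} (w : Equiv.Perm (Fin n)) : ℕ :=
  (Finset.univ.filter (fun p : Fin n × Fin n => p.1 < p.2 ∧ w p.2 < w p.1)).card

/-- `sGen n i` is the adjacent transposition `s_i = (i, i+1)` (1-based) in `S_n`;
it is the identity for out-of-range `i`. -/
def sGen (n i : ℕ) : Equiv.Perm (Fin n) :=
  if h : 1 ≤ i ∧ i < n then Equiv.swap ⟨i - 1, by omega⟩ ⟨i, h.2⟩ else 1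

/-- `pimg d i` is the (1-based) image `(i)d` of the point `i ∈ {1,…,n}` under the
*right* action of the permutation `d` (permutations act on points on the right,
so that `(a)(στ) = ((a)σ)τ` for the group multiplication `σ * τ`);
the junk value `0` is returned for out-of-range `i`. -/
def pimg {n : ℕ} (d : Equiv.Perm (Fin n)) (i : ℕ) : ℕ :=
  if h : i - 1 < n then ((d⁻¹ ⟨i - 1, h⟩ : Fin n) : ℕ) + 1 else 0

open scoped Classical in
/-- `Hset n f` is the set `H_f(n)` of all `d ∈ S_n` such that
`(1)d < (3)d < ⋯ < (2f-1)d`, `(2i-1)d < (2i)d` for `i = 1,…,f`, and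
`(2f+1)d < (2f+2)d < ⋯ < (n)d`. -/
noncomputable def Hset (n f : ℕ) : Finset (Equiv.Perm (Fin n)) :=
  Finset.univ.filter (fun d =>
    (∀ i ∈ Finset.Icc 1 (f - 1), pimg d (2 * i - 1) < pimg d (2 * i + 1)) ∧
    (∀ i ∈ Finset.Icc 1 f, pimg d (2 * i - 1) < pimg d (2 * i)) ∧
    (∀ j ∈ Finset.Icc (2 * f + 1) (n - 1), pimg d j < pimg d (j + 1)))

/-- The index of the block of the composition `μ` containing the (0-based) point `k`. -/
def blockOf (μ : List ℕ) (k : ℕ) : ℕ :=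
  ((List.range μ.length).filter (fun j => (μ.take (j + 1)).sum ≤ k)).length

open scoped Classical in
/-- The Young subgroup `S_μ` of `S_n` associated with a composition `μ` of `n`,
as the set of permutations preserving each of the consecutive blocks of `μ`. -/
noncomputable def youngSet (n : ℕ) (μ : List ℕ) : Finset (Equiv.Perm (Fin n)) :=
  Finset.univ.filter (fun w => ∀ a : Fin n, blockOf μ ((w a : ℕ)) = blockOf μ (a : ℕ))

open scoped Classical in
/-- The set `D_μ` of minimal-length right coset representatives of `S_μ` in `S_n`:
the elements of minimal length in their right coset `S_μ d`. -/
noncomputable def Dset (n : ℕ) (μ : List ℕ) : Finset (Equiv.Perm (Fin n)) :=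
  Finset.univ.filter (fun d => ∀ u ∈ youngSet n μ, len d ≤ len (u * d))

/-- The identification of `Fin m` with the block `[k, k+m)` of `Fin n` (0-based). -/
def shiftEquiv (n k m : ℕ) (h : k + m ≤ n) :
    Fin m ≃ {a : Fin n // k ≤ (a : ℕ) ∧ (a : ℕ) < k + m} where
  toFun b := ⟨⟨k + (b : ℕ), by have := b.isLt; omega⟩, by
    constructor
    · exact Nat.le_add_right _ _
    · have := b.isLt; simp only [Fin.val_mk]; omega⟩
  invFun a := ⟨(a : Fin n) - k, by have := a.2; omega⟩
  left_inv b := by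
    apply Fin.ext
    simp
  right_inv a := by
    apply Subtype.ext
    apply Fin.ext
    have := a.2
    simp only []
    omega

open scoped Classical in
/-- The embedding of `S_m` into `S_n` as the group of permutations of the
(1-based) block `{k+1, …, k+m}` of `{1, …, n}`. -/
noncomputable def shiftEmb (n k m : ℕ) (w : Equiv.Perm (Fin m)) : Equiv.Perm (Fin n) :=
  if h : k + m ≤ n then w.extendDomain (shiftEquiv n k m h) else 1

open scoped Classical in
/-- The subgroup of `S_n` of permutations fixing the (1-based) points `1, …, k`. -/
noncomputable def fixSet (n k : ℕ) : Finset (Equiv.Perm (Fin n)) :=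
  Finset.univ.filter (fun w => ∀ a : Fin n, (a : ℕ) < k → w a = a)


/-- `bbs n i` is the permutation `𝕤_i = s_{2i} s_{2i-1} s_{2i+1} s_{2i} = (2i-1, 2i+1)(2i, 2i+2)`. -/
def bbs (n i : ℕ) : Equiv.Perm (Fin n) :=
  sGen n (2 * i) * sGen n (2 * i - 1) * sGen n (2 * i + 1) * sGen n (2 * i)

open scoped Classical in
/-- The set `𝔻_{(1,f-1)} = {𝕤_1 𝕤_2 ⋯ 𝕤_k : k = 0, …, f-1}` in `S_{2f}`. -/
noncomputable def bbD1 (f : ℕ) : Finset (Equiv.Perm (Fin (2 * f))) :=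
  (Finset.range f).image (fun k => ((List.range k).map (fun j => bbs (2 * f) (j + 1))).prod)

open scoped Classical in
/-- The set `𝔻_{(1,f-2)}^{{2,…,f}} = {𝕤_2 𝕤_3 ⋯ 𝕤_k : k = 1, …, f-1}` in `S_{2f}`. -/
noncomputable def bbD1' (f : ℕ) : Finset (Equiv.Perm (Fin (2 * f))) :=
  (Finset.Icc 1 (f - 1)).image
    (fun k => ((List.range (k - 1)).map (fun j => bbs (2 * f) (j + 2))).prod)

open scoped Classical in
/-- `H_f^{(a)} = {d ∈ H_f(n) : (1)d⁻¹ = 1, (2)d⁻¹ = 2}`. -/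
noncomputable def HsetA (n f : ℕ) : Finset (Equiv.Perm (Fin n)) :=
  (Hset n f).filter (fun d => pimg d⁻¹ 1 = 1 ∧ pimg d⁻¹ 2 = 2)

open scoped Classical in
/-- `H_f^{(b)} = {d ∈ H_f(n) : (1)d⁻¹ = 1, (2)d⁻¹ = 3}`. -/
noncomputable def HsetB (n f : ℕ) : Finset (Equiv.Perm (Fin n)) :=
  (Hset n f).filter (fun d => pimg d⁻¹ 1 = 1 ∧ pimg d⁻¹ 2 = 3)

open scoped Classical in
/-- `H_f^{(c)} = {d ∈ H_f(n) : (1)d⁻¹ = 1, (2)d⁻¹ = 2f+1}`. -/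
noncomputable def HsetC (n f : ℕ) : Finset (Equiv.Perm (Fin n)) :=
  (Hset n f).filter (fun d => pimg d⁻¹ 1 = 1 ∧ pimg d⁻¹ 2 = 2 * f + 1)

open scoped Classical in
/-- `H_f^{(d)} = {d ∈ H_f(n) : (1)d⁻¹ = 2f+1, (2)d⁻¹ = 1}`. -/
noncomputable def HsetD (n f : ℕ) : Finset (Equiv.Perm (Fin n)) :=
  (Hset n f).filter (fun d => pimg d⁻¹ 1 = 2 * f + 1 ∧ pimg d⁻¹ 2 = 1)

open scoped Classical in
/-- `H_f^{(e)} = {d ∈ H_f(n) : (1)d⁻¹ = 2f+1, (2)d⁻¹ = 2f+2}`. -/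
noncomputable def HsetE (n f : ℕ) : Finset (Equiv.Perm (Fin n)) :=
  (Hset n f).filter (fun d => pimg d⁻¹ 1 = 2 * f + 1 ∧ pimg d⁻¹ 2 = 2 * f + 2)

section Algebra

variable {F : Type*} [Field F] {A : Type*} [Ring A] [Algebra F A]

/-- For a set `S` of permutations, `hat c Tw S = Σ_{w ∈ S} c^{ℓ(w)} T_w`. -/
noncomputable def hat {n : ℕ} (c : F) (Tw : Equiv.Perm (Fin n) → A)
    (S : Finset (Equiv.Perm (Fin n))) : A :=
  ∑ w ∈ S, c ^ len w • Tw w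

/-- `Ehat E f = E_1 E_3 ⋯ E_{2f-1}`. -/
def Ehat (E : ℕ → A) (f : ℕ) : A := ((List.range f).map (fun i => E (2 * i + 1))).prod

/-- `Tprod T a b = T_a T_{a+1} ⋯ T_b` (the empty product `1` if `b < a`). -/
def Tprod (T : ℕ → A) (a b : ℕ) : A := ((List.range (b + 1 - a)).map (fun t => T (a + t))).prod

/-- `sDesc n a b = s_a s_{a-1} ⋯ s_b` (descending product of adjacent transpositions). -/
def sDesc (n a b : ℕ) : Equiv.Perm (Fin n) :=
  ((List.range (a + 1 - b)).map (fun j => sGen n (a - j))).prod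

/-- The data of a Birman–Murakami–Wenzl algebra structure: an `F`-algebra `A`
with invertible elements `T_1, …, T_{n-1}` and elements `E_1, …, E_{n-1}`
satisfying the BMW relations, together with a map `w ↦ T_w` from `S_n` to `A`
with `T_id = 1`, `T_{s_i} = T_i` and `T_{uv} = T_u T_v` whenever lengths add. -/
structure BMWData (F : Type*) [Field F] (A : Type*) [Ring A] [Algebra F A]
    (n : ℕ) (q r : F) where
  T : ℕ → A
  Tinv : ℕ → A
  E : ℕ → A
  Tw : Equiv.Perm (Fin n) → A
  hq : q ≠ 0
  hr : r ≠ 0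
  hqq : q - q⁻¹ ≠ 0
  T_mul_Tinv : ∀ i, 1 ≤ i → i ≤ n - 1 → T i * Tinv i = 1
  Tinv_mul_T : ∀ i, 1 ≤ i → i ≤ n - 1 → Tinv i * T i = 1
  skein : ∀ i, 1 ≤ i → i ≤ n - 1 → T i - Tinv i = (q - q⁻¹) • (1 - E i)
  Esq : ∀ i, 1 ≤ i → i ≤ n - 1 → E i * E i = (1 + (r - r⁻¹) / (q - q⁻¹)) • E i
  braid : ∀ i, 1 ≤ i → i + 1 ≤ n - 1 → T i * T (i + 1) * T i = T (i + 1) * T i * T (i + 1)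
  T_comm : ∀ i j, 1 ≤ i → i ≤ n - 1 → 1 ≤ j → j ≤ n - 1 → (i + 1 < j ∨ j + 1 < i) →
    T i * T j = T j * T i
  EEE₁ : ∀ i, 1 ≤ i → i + 1 ≤ n - 1 → E i * E (i + 1) * E i = E i
  EEE₂ : ∀ i, 1 ≤ i → i + 1 ≤ n - 1 → E (i + 1) * E i * E (i + 1) = E (i + 1)
  TTE₁ : ∀ i, 1 ≤ i → i + 1 ≤ n - 1 → T i * T (i + 1) * E i = E (i + 1) * E i
  TTE₂ : ∀ i, 1 ≤ i → i + 1 ≤ n - 1 → T (i + 1) * T i * E (i + 1) = E i * E (i + 1)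
  ET : ∀ i, 1 ≤ i → i ≤ n - 1 → E i * T i = r⁻¹ • E i
  TE : ∀ i, 1 ≤ i → i ≤ n - 1 → T i * E i = r⁻¹ • E i
  ETE₁ : ∀ i, 1 ≤ i → i + 1 ≤ n - 1 → E i * T (i + 1) * E i = r • E i
  ETE₂ : ∀ i, 1 ≤ i → i + 1 ≤ n - 1 → E (i + 1) * T i * E (i + 1) = r • E (i + 1)
  Tw_one : Tw 1 = 1
  Tw_s : ∀ i, 1 ≤ i → i ≤ n - 1 → Tw (sGen n i) = T i
  Tw_mul : ∀ u v : Equiv.Perm (Fin n), len (u * v) = len u + len v →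
    Tw (u * v) = Tw u * Tw v

/-- The scalars `a_f` defined by `a_0 = 1` and `a_i = a_{i-1} · Σ_{k=0}^{i-1} q^{2k}`. -/
noncomputable def aseq (q : F) : ℕ → F
  | 0 => 1
  | (i + 1) => aseq q i * (∑ k ∈ Finset.range (i + 1), q ^ (2 * k))


/-- The scalars `c_f` defined by `c_0 = 1` and
`c_f = -((q^{4f-3} - q^{2f-3})/(r q^{2n-2f-2} - q⁻¹)) · c_{f-1}`. -/
noncomputable def cseq (q r : F) (n : ℕ) : ℕ → F
  | 0 => 1
  | (f + 1) =>
      -((q ^ (4 * ((f : ℤ) + 1) - 3) - q ^ (2 * ((f : ℤ) + 1) - 3)) /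
          (r * q ^ (2 * (n : ℤ) - 2 * ((f : ℤ) + 1) - 2) - q⁻¹)) * cseq q r n f

/-- The scalars `č_f` defined by `č_0 = 1` and
`č_f = (q^{3-4f}(1 - q^{2f})/(q + r q^{2+2f-2n})) · č_{f-1}` (with integer exponents). -/
noncomputable def ccseq (q r : F) (n : ℕ) : ℕ → F
  | 0 => 1
  | (f + 1) =>
      (q ^ ((3 : ℤ) - 4 * ((f : ℤ) + 1)) * (1 - q ^ (2 * (f + 1))) /
          (q + r * q ^ ((2 : ℤ) + 2 * ((f : ℤ) + 1) - 2 * (n : ℤ)))) * ccseq q r n f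

/-- The element `x_f = (H_f⁻¹)^ · Ŝ_{{2f+1,…,n}} · Ê_f · Ĥ_f` of the BMW algebra. -/
noncomputable def xEl {F : Type*} [Field F] {A : Type*} [Ring A] [Algebra F A]
    {n : ℕ} {q r : F} (D : BMWData F A n q r) (f : ℕ) : A :=
  hat q D.Tw ((Hset n f).image (fun d => d⁻¹)) * hat q D.Tw (fixSet n (2 * f)) *
    Ehat D.E f * hat q D.Tw (Hset n f)

/-- The element `x̌_f = (H_f⁻¹)ˇ · Š_{{2f+1,…,n}} · Ê_f · Ȟ_f` of the BMW algebra,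
where `ˇ` is formed with `-q⁻¹` in place of `q`. -/
noncomputable def xElCheck {F : Type*} [Field F] {A : Type*} [Ring A] [Algebra F A]
    {n : ℕ} {q r : F} (D : BMWData F A n q r) (f : ℕ) : A :=
  hat (-q⁻¹) D.Tw ((Hset n f).image (fun d => d⁻¹)) * hat (-q⁻¹) D.Tw (fixSet n (2 * f)) *
    Ehat D.E f * hat (-q⁻¹) D.Tw (Hset n f)

end Algebra

section Relations

variable {F : Type*} [Field F] {A : Type*} [Ring A] [Algebra F A] {n : ℕ} {q r : F}

namespace BMWData

variable (D : BMWData F A n q r)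

theorem E_eq {i : ℕ} (h1 : 1 ≤ i) (h2 : i < n) :
    D.E i = 1 - (q - q⁻¹)⁻¹ • (D.T i - D.Tinv i) := by
  rw [D.skein i h1 (by omega), smul_smul, inv_mul_cancel₀ D.hqq, one_smul, sub_sub_cancel]

theorem Tinv_eq {i : ℕ} (h1 : 1 ≤ i) (h2 : i < n) :
    D.Tinv i = D.T i - (q - q⁻¹) • (1 - D.E i) := by
  rw [← D.skein i h1 (by omega), sub_sub_cancel]

/-- If `x` intertwines `T_i` and `T_j`, it intertwines `E_i` and `E_j`. -/
theorem semiconj_E {x : A} {i j : ℕ} (hi : 1 ≤ i) (hi' : i < n) (hj : 1 ≤ j) (hj' : j < n)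
    (h : x * D.T i = D.T j * x) : x * D.E i = D.E j * x := by
  have h' : x * D.Tinv i = D.Tinv j * x := by
    calc x * D.Tinv i = D.Tinv j * D.T j * x * D.Tinv i := by
          rw [D.Tinv_mul_T j hj (by omega), one_mul]
      _ = D.Tinv j * (x * D.T i) * D.Tinv i := by rw [h]; simp only [mul_assoc]
      _ = D.Tinv j * x * (D.T i * D.Tinv i) := by simp only [mul_assoc]
      _ = D.Tinv j * x := by rw [D.T_mul_Tinv i hi (by omega), mul_one]
  rw [D.E_eq hi hi', D.E_eq hj hj', mul_sub, sub_mul, mul_one, one_mul, mul_smul_comm,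
    smul_mul_assoc, mul_sub, sub_mul, h, h']

theorem commute_E {x : A} {i : ℕ} (h1 : 1 ≤ i) (h2 : i < n) (h : Commute x (D.T i)) :
    Commute x (D.E i) :=
  D.semiconj_E h1 h2 h1 h2 h

theorem commute_T_T {i j : ℕ} (h1 : 1 ≤ i) (h2 : i + 1 < j) (h3 : j < n) :
    Commute (D.T i) (D.T j) :=
  D.T_comm i j h1 (by omega) (by omega) (by omega) (.inl h2)

theorem commute_E_T {i j : ℕ} (h1 : 1 ≤ i) (h2 : i + 1 < j) (h3 : j < n) :
    Commute (D.E i) (D.T j) :=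
  (D.commute_E h1 (by omega) (D.commute_T_T h1 h2 h3).symm).symm

theorem commute_T_E {i j : ℕ} (h1 : 1 ≤ i) (h2 : i + 1 < j) (h3 : j < n) :
    Commute (D.T i) (D.E j) :=
  D.commute_E (by omega) h3 (D.commute_T_T h1 h2 h3)

theorem commute_E_E {i j : ℕ} (h1 : 1 ≤ i) (h2 : i + 1 < j) (h3 : j < n) :
    Commute (D.E i) (D.E j) :=
  D.commute_E (by omega) h3 (D.commute_E_T h1 h2 h3)

theorem T_sq {i : ℕ} (h1 : 1 ≤ i) (h2 : i < n) :
    D.T i * D.T i = 1 + (q - q⁻¹) • (D.T i - r⁻¹ • D.E i) := by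
  have h : D.T i * (D.T i - D.Tinv i) = D.T i * ((q - q⁻¹) • (1 - D.E i)) := by
    rw [D.skein i h1 (by omega)]
  rw [mul_sub, D.T_mul_Tinv i h1 (by omega), mul_smul_comm, mul_sub, mul_one,
    D.TE i h1 (by omega), sub_eq_iff_eq_add] at h
  rw [h, add_comm]

theorem T_T_E {i : ℕ} (h1 : 1 ≤ i) (h2 : i + 1 < n) :
    D.T i * D.T (i + 1) * D.E i = D.E (i + 1) * (D.T i * D.T (i + 1)) :=
  D.semiconj_E h1 (by omega) (by omega) h2
    (by rw [D.braid i h1 (by omega)]; simp only [mul_assoc])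

theorem T_T_E' {i : ℕ} (h1 : 1 ≤ i) (h2 : i + 1 < n) :
    D.T (i + 1) * D.T i * D.E (i + 1) = D.E i * (D.T (i + 1) * D.T i) :=
  D.semiconj_E (by omega) h2 h1 (by omega)
    (by rw [← D.braid i h1 (by omega)]; simp only [mul_assoc])

theorem E_T_T {i : ℕ} (h1 : 1 ≤ i) (h2 : i + 1 < n) :
    D.E (i + 1) * (D.T i * D.T (i + 1)) = D.E (i + 1) * D.E i := by
  rw [← D.T_T_E h1 h2, D.TTE₁ i h1 (by omega)]

theorem E_T_T' {i : ℕ} (h1 : 1 ≤ i) (h2 : i + 1 < n) :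
    D.E i * (D.T (i + 1) * D.T i) = D.E i * D.E (i + 1) := by
  rw [← D.T_T_E' h1 h2, D.TTE₂ i h1 (by omega)]

/-- `E_i E_{i+1} T_i = E_i T_{i+1}⁻¹`. -/
theorem E_E_T {i : ℕ} (h1 : 1 ≤ i) (h2 : i + 1 < n) :
    D.E i * D.E (i + 1) * D.T i =
      D.E i * (D.T (i + 1) - (q - q⁻¹) • (1 - D.E (i + 1))) := by
  rw [← D.Tinv_eq (by omega) h2]
  calc D.E i * D.E (i + 1) * D.T i
      = D.E i * (D.E (i + 1) * (D.T i * D.T (i + 1))) * D.Tinv (i + 1) := by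
        simp only [mul_assoc]
        rw [D.T_mul_Tinv (i + 1) (by omega) (by omega), mul_one]
    _ = D.E i * D.Tinv (i + 1) := by
        rw [D.E_T_T h1 h2, ← mul_assoc, D.EEE₁ i h1 (by omega)]

theorem E_E_T_T {i : ℕ} (h1 : 1 ≤ i) (h2 : i + 2 < n) :
    D.E i * D.E (i + 2) * (D.T (i + 1) * D.T (i + 2) * (D.T i * D.T (i + 1))) =
      D.E i * D.E (i + 2) := by
  have e1 := D.E_T_T (i := i + 1) (by omega) (by omega)
  have e2 := D.E_T_T h1 (by omega : i + 1 < n)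
  have e3 := D.EEE₁ i h1 (by omega)
  have c := (D.commute_E_E h1 (by omega : i + 1 < i + 2) h2).eq
  calc D.E i * D.E (i + 2) * (D.T (i + 1) * D.T (i + 2) * (D.T i * D.T (i + 1)))
      = D.E i * (D.E (i + 2) * (D.T (i + 1) * D.T (i + 2))) * (D.T i * D.T (i + 1)) := by
        simp only [mul_assoc]
    _ = D.E i * D.E (i + 2) * (D.E (i + 1) * (D.T i * D.T (i + 1))) := by
        rw [e1]; simp only [mul_assoc]
    _ = D.E (i + 2) * (D.E i * D.E (i + 1) * D.E i) := by
        rw [e2, c]; simp only [mul_assoc]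
    _ = D.E i * D.E (i + 2) := by rw [e3, c]

end BMWData

end Relations

section Sums

variable {F : Type*} [Field F] {A : Type*} [Ring A] [Algebra F A] {n : ℕ} {q r : F}

namespace BMWData

variable (D : BMWData F A n q r)

/-- `ascSum m a = 1 + q T_a + q² T_a T_{a+1} + ⋯ + q^m T_a ⋯ T_{a+m-1}`. -/
def ascSum : ℕ → ℕ → A
  | 0, _ => 1
  | m + 1, a => 1 + q • (D.T a * ascSum m (a + 1))

/-- `descProd k l = T_{k+l} ⋯ T_{k+1}`. -/
def descProd (k : ℕ) : ℕ → A
  | 0 => 1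
  | l + 1 => D.T (k + l + 1) * descProd k l

/-- `cupProd k f = E_{k+1} E_{k+3} ⋯ E_{k+2f-1}`. -/
def cupProd : ℕ → ℕ → A
  | _, 0 => 1
  | k, f + 1 => D.E (k + 1) * cupProd (k + 2) f

/-- The sum `Ĥ_f` over the permutations of the `m` points `k+1, …, k+m`, defined by recursion
on whether the first point starts an arc or is free. -/
def arcSum : ℕ → ℕ → ℕ → A
  | _, 0, _ => 1
  | 0, _ + 1, _ => 0
  | 1, _ + 1, _ => 0
  | m + 2, f + 1, k => arcSum m f (k + 2) * D.ascSum m (k + 2) +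
      q ^ (2 * f + 2) • (D.descProd k (2 * f + 2) * arcSum (m + 1) (f + 1) (k + 1))

@[simp] theorem ascSum_zero (a : ℕ) : D.ascSum 0 a = 1 := rfl

theorem ascSum_succ (m a : ℕ) :
    D.ascSum (m + 1) a = 1 + q • (D.T a * D.ascSum m (a + 1)) := rfl

@[simp] theorem descProd_zero (k : ℕ) : D.descProd k 0 = 1 := rfl

theorem descProd_succ (k l : ℕ) :
    D.descProd k (l + 1) = D.T (k + l + 1) * D.descProd k l := rfl

@[simp] theorem cupProd_zero (k : ℕ) : D.cupProd k 0 = 1 := rfl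

theorem cupProd_succ (k f : ℕ) :
    D.cupProd k (f + 1) = D.E (k + 1) * D.cupProd (k + 2) f := rfl

@[simp] theorem arcSum_zero (m k : ℕ) : D.arcSum m 0 k = 1 := by
  rw [arcSum]

theorem arcSum_succ (m f k : ℕ) :
    D.arcSum (m + 2) (f + 1) k = D.arcSum m f (k + 2) * D.ascSum m (k + 2) +
      q ^ (2 * f + 2) • (D.descProd k (2 * f + 2) * D.arcSum (m + 1) (f + 1) (k + 1)) := by
  rw [arcSum]

theorem arcSum_eq_zero : ∀ {m f : ℕ} (k : ℕ), m < 2 * f → D.arcSum m f k = 0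
  | _, 0, _, h => by omega
  | 0, _ + 1, _, _ => rfl
  | 1, _ + 1, _, _ => rfl
  | m + 2, f + 1, k, h => by
    rw [arcSum_succ, arcSum_eq_zero _ (by omega), arcSum_eq_zero _ (by omega)]
    simp

theorem descProd_succ' (k l : ℕ) :
    D.descProd k (l + 1) = D.descProd (k + 1) l * D.T (k + 1) := by
  induction l with
  | zero => simp [descProd_succ]
  | succ l ih =>
    rw [descProd_succ, ih, descProd_succ, mul_assoc]
    congr 2
    omega

theorem descProd_add_two (k l : ℕ) :
    D.descProd k (l + 2) = D.descProd (k + 2) l * (D.T (k + 2) * D.T (k + 1)) := by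
  rw [descProd_succ', descProd_succ', mul_assoc]

theorem cupProd_succ' (k f : ℕ) :
    D.cupProd k (f + 1) = D.cupProd k f * D.E (k + 2 * f + 1) := by
  induction f generalizing k with
  | zero => simp [cupProd_succ]
  | succ f ih =>
    rw [cupProd_succ, ih, cupProd_succ, mul_assoc]
    congr 3
    omega

theorem cupProd_eq_Ehat (f : ℕ) : D.cupProd 0 f = Ehat D.E f := by
  induction f with
  | zero => rfl
  | succ f ih =>
    rw [cupProd_succ', ih]
    simp [Ehat, List.range_succ]

variable {D}

theorem commute_ascSum {x : A} {m a : ℕ}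
    (h : ∀ j, a ≤ j → j < a + m → Commute x (D.T j)) : Commute x (D.ascSum m a) := by
  induction m generalizing a with
  | zero => exact Commute.one_right x
  | succ m ih =>
    rw [ascSum_succ]
    exact (Commute.one_right x).add_right (((h a le_rfl (by omega)).mul_right
      (ih fun j h1 h2 => h j (by omega) (by omega))).smul_right q)

theorem commute_descProd {x : A} {k l : ℕ}
    (h : ∀ j, k < j → j ≤ k + l → Commute x (D.T j)) : Commute x (D.descProd k l) := by
  induction l with
  | zero => exact Commute.one_right x
  | succ l ih =>
    exact (h _ (by omega) (by omega)).mul_right (ih fun j h1 h2 => h j h1 (by omega))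

theorem commute_cupProd {x : A} {k f : ℕ}
    (h : ∀ j, k < j → j < k + 2 * f → Commute x (D.E j)) : Commute x (D.cupProd k f) := by
  induction f generalizing k with
  | zero => exact Commute.one_right x
  | succ f ih =>
    exact (h _ (by omega) (by omega)).mul_right (ih fun j h1 h2 => h j (by omega) (by omega))

theorem commute_arcSum {x : A} : ∀ {m f k : ℕ},
    (∀ j, k < j → j < k + m → Commute x (D.T j)) → Commute x (D.arcSum m f k)
  | m, 0, k, _ => by rw [arcSum_zero]; exact Commute.one_right x
  | 0, _ + 1, _, _ => Commute.zero_right x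
  | 1, _ + 1, _, _ => Commute.zero_right x
  | m + 2, f + 1, k, h => by
    by_cases hm : m < 2 * f
    · rw [arcSum_eq_zero _ _ (by omega)]
      exact Commute.zero_right x
    rw [arcSum_succ]
    refine ((commute_arcSum fun j h1 h2 => h j (by omega) (by omega)).mul_right
      (commute_ascSum fun j h1 h2 => h j (by omega) (by omega))).add_right ?_
    rcases (by omega : m = 2 * f ∨ 2 * f < m) with rfl | hm'
    · rw [arcSum_eq_zero _ _ (by omega), mul_zero, smul_zero]
      exact Commute.zero_right x
    exact ((commute_descProd fun j h1 h2 => h j (by omega) (by omega)).mul_right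
      (commute_arcSum fun j h1 h2 => h j (by omega) (by omega))).smul_right _

variable (D)

theorem arcSum_one_succ (m k : ℕ) :
    D.arcSum (m + 2) 1 k = D.ascSum m (k + 2) +
      q ^ 2 • (D.T (k + 2) * (D.T (k + 1) * D.arcSum (m + 1) 1 (k + 1))) := by
  rw [arcSum_succ, arcSum_zero, one_mul]
  simp [descProd_succ, mul_assoc]

/-- Choosing two points in order, and choosing a pair of points and then its orientation. -/
theorem one_add_mul_arcSum_one (m k : ℕ) (h : k + m + 2 = n) :
    (1 + q • D.T (k + 1)) * D.arcSum (m + 2) 1 k =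
      D.ascSum m (k + 2) * D.ascSum (m + 1) (k + 1) := by
  induction m generalizing k with
  | zero =>
    rw [arcSum_one_succ, arcSum_eq_zero _ _ (by omega)]
    simp [ascSum_succ]
  | succ m ih =>
    have ih' := ih (k + 1) (by omega)
    have b := D.braid (k + 1) (by omega) (by omega)
    simp only [Nat.add_assoc, Nat.reduceAdd] at ih' b
    have c : Commute (D.T (k + 1)) (D.ascSum m (k + 3)) :=
      commute_ascSum fun j h1 h2 => D.commute_T_T (by omega) (by omega) (by omega)
    have key : (1 + q • D.T (k + 1)) * (D.T (k + 2) * D.T (k + 1)) =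
        D.T (k + 2) * D.T (k + 1) * (1 + q • D.T (k + 2)) := by
      simp only [add_mul, mul_add, one_mul, mul_one, smul_mul_assoc, mul_smul_comm]
      rw [← b, mul_assoc]
    have e : D.ascSum (m + 1) (k + 2) * D.T (k + 1) * D.ascSum (m + 1) (k + 2) =
        D.T (k + 1) * D.ascSum (m + 1) (k + 2) +
          q • (D.T (k + 2) * D.T (k + 1) * ((1 + q • D.T (k + 2)) *
            D.arcSum (m + 2) 1 (k + 1))) := by
      rw [ih']
      nth_rw 1 [ascSum_succ]
      simp only [add_mul, one_mul, smul_mul_assoc, mul_assoc, Nat.add_assoc, Nat.reduceAdd]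
      rw [← mul_assoc (D.ascSum m (k + 3)), ← c.eq, mul_assoc]
    have s : D.ascSum (m + 1 + 1) (k + 1) = 1 + q • (D.T (k + 1) * D.ascSum (m + 1) (k + 2)) :=
      rfl
    rw [s, mul_add, mul_one, mul_smul_comm, ← mul_assoc, e, arcSum_one_succ, mul_add,
      mul_smul_comm, ← mul_assoc (D.T (k + 2)), ← mul_assoc, key]
    simp only [add_mul, one_mul, smul_mul_assoc, smul_add, smul_smul, mul_assoc, pow_two,
      add_assoc, Nat.reduceAdd]

theorem semiconj_descProd_T {k l i : ℕ} (h1 : k < i) (h2 : i < k + l) (h3 : k + l < n) :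
    D.descProd k l * D.T (i + 1) = D.T i * D.descProd k l := by
  induction l with
  | zero => omega
  | succ l ih =>
    rcases (by omega : i < k + l ∨ i = k + l) with hi | rfl
    · rw [descProd_succ, mul_assoc, ih hi (by omega), ← mul_assoc, ← mul_assoc,
        (D.commute_T_T (by omega) (by omega : i + 1 < k + l + 1) (by omega)).eq]
    · obtain ⟨l, rfl⟩ : ∃ l', l = l' + 1 := ⟨l - 1, by omega⟩
      have b := D.braid (k + l + 1) (by omega) (by omega)
      have c : Commute (D.T (k + l + 2)) (D.descProd k l) := commute_descProd fun j _ _ =>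
        (D.commute_T_T (by omega) (by omega) (by omega)).symm
      rw [descProd_succ, descProd_succ]
      simp only [← Nat.add_assoc]
      rw [mul_assoc, mul_assoc, ← c.eq, ← mul_assoc, ← mul_assoc, ← b]
      simp only [mul_assoc]

theorem semiconj_descProd_E {k l i : ℕ} (h1 : k < i) (h2 : i < k + l) (h3 : k + l < n) :
    D.descProd k l * D.E (i + 1) = D.E i * D.descProd k l :=
  D.semiconj_E (by omega) (by omega) (by omega) (by omega) (D.semiconj_descProd_T h1 h2 h3)

theorem descProd_mul_cupProd {k l j f : ℕ} (h1 : k ≤ j) (h2 : j + 2 * f ≤ k + l)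
    (h3 : k + l < n) :
    D.descProd k l * D.cupProd (j + 1) f = D.cupProd j f * D.descProd k l := by
  induction f generalizing j with
  | zero => simp
  | succ f ih =>
    have := ih (j := j + 2) (by omega) (by omega)
    rw [cupProd_succ, cupProd_succ, ← mul_assoc,
      D.semiconj_descProd_E (by omega) (by omega) h3, mul_assoc, mul_assoc, ← this]

theorem descProd_mul_descProd_succ (k l : ℕ) (h : k + l + 2 < n) :
    D.descProd k (l + 1) * D.descProd (k + 1) (l + 1) =
      D.T (k + l + 1) * D.T (k + l + 2) * (D.descProd k l * D.descProd (k + 1) l) := by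
  have c : Commute (D.T (k + l + 2)) (D.descProd k l) := commute_descProd fun j _ _ =>
    (D.commute_T_T (by omega) (by omega) (by omega)).symm
  rw [descProd_succ, descProd_succ, (by omega : k + 1 + l + 1 = k + l + 2)]
  simp only [mul_assoc]
  rw [← mul_assoc (D.descProd k l), ← c.eq]
  simp only [mul_assoc]

theorem descProd_mul_descProd_mul_E (k l : ℕ) (h : k + l + 1 < n) :
    D.descProd k l * D.descProd (k + 1) l * D.E (k + 1) =
      D.E (k + l + 1) * (D.descProd k l * D.descProd (k + 1) l) := by
  induction l with
  | zero => simp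
  | succ l ih =>
    have t := D.T_T_E (i := k + l + 1) (by omega) (by omega)
    rw [D.descProd_mul_descProd_succ k l (by omega), mul_assoc, ih (by omega), ← mul_assoc, t]
    simp only [mul_assoc, Nat.add_assoc, Nat.reduceAdd]

/-- Two parallel strands can be pulled across the arcs. -/
theorem cupProd_mul_descProd_mul_descProd (k f : ℕ) (h : k + 2 * f + 1 < n) :
    D.cupProd k (f + 1) * (D.descProd k (2 * f) * D.descProd (k + 1) (2 * f)) =
      D.cupProd k (f + 1) := by
  induction f with
  | zero => simp
  | succ f ih =>
    have t := D.E_E_T_T (i := k + 2 * f + 1) (by omega) (by omega)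
    have d1 := D.descProd_mul_descProd_succ k (2 * f + 1) (by omega)
    have d2 := D.descProd_mul_descProd_succ k (2 * f) (by omega)
    have c : Commute (D.E (k + 2 * f + 3))
        (D.descProd k (2 * f) * D.descProd (k + 1) (2 * f)) :=
      (commute_descProd fun j _ _ =>
          (D.commute_T_E (by omega) (by omega) (by omega)).symm).mul_right
        (commute_descProd fun j _ _ =>
          (D.commute_T_E (by omega) (by omega) (by omega)).symm)
    have ih' := ih (by omega)
    rw [cupProd_succ'] at ih'
    have e : D.cupProd k (f + 1 + 1) =
        D.cupProd k f * (D.E (k + 2 * f + 1) * D.E (k + 2 * f + 3)) := by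
      rw [cupProd_succ', cupProd_succ', mul_assoc]
      congr 3
    rw [e, Nat.mul_add, Nat.mul_one, d1, d2]
    simp only [Nat.add_assoc, Nat.reduceAdd] at t c ih' ⊢
    generalize D.descProd k (2 * f) * D.descProd (k + 1) (2 * f) = x at c ih' ⊢
    rw [← mul_assoc (_ * _) (_ * _) x, ← mul_assoc, mul_assoc (D.cupProd k f), t, mul_assoc,
      mul_assoc, c.eq, ← mul_assoc, ← mul_assoc, ih', mul_assoc]

end BMWData

end Sums

section Identities

variable {F : Type*} [Field F] {A : Type*} [Ring A] [Algebra F A] {n : ℕ} {q r : F}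

/-- The `q²`-integer `1 + q² + ⋯ + q^{2(f-1)}`. -/
def qint (q : F) (f : ℕ) : F := ∑ i ∈ range f, q ^ (2 * i)

@[simp] theorem qint_zero (q : F) : qint q 0 = 0 := by simp [qint]

@[simp] theorem qint_one (q : F) : qint q 1 = 1 := by simp [qint]

theorem qint_succ (q : F) (f : ℕ) : qint q (f + 1) = qint q f + q ^ (2 * f) := by
  simp [qint, sum_range_succ]

theorem qint_succ' (q : F) (f : ℕ) : qint q (f + 1) = 1 + q ^ 2 * qint q f := by
  simp only [qint, sum_range_succ', mul_sum, mul_zero, pow_zero, mul_add, mul_one, pow_add]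
  rw [add_comm]
  congr 1
  exact sum_congr rfl fun _ _ => mul_comm _ _

theorem qint_mul (q : F) (f : ℕ) : (q ^ 2 - 1) * qint q f = q ^ (2 * f) - 1 := by
  induction f with
  | zero => simp
  | succ f ih =>
    rw [qint_succ, mul_add, ih]
    ring

namespace BMWData

variable (D : BMWData F A n q r)

theorem descProd_mul_descProd_shift {k l j i : ℕ} (h1 : k ≤ j) (h2 : j + i < k + l)
    (h3 : k + l < n) :
    D.descProd k l * D.descProd (j + 1) i = D.descProd j i * D.descProd k l := by
  induction i with
  | zero => simp
  | succ i ih =>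
    rw [descProd_succ, descProd_succ, ← mul_assoc, (by omega : j + 1 + i + 1 = (j + i + 1) + 1),
      D.semiconj_descProd_T (by omega) (by omega) h3, mul_assoc, ih (by omega), ← mul_assoc]

theorem descProd_mul_descProd_mul_T (k l : ℕ) (h : k + l + 1 < n) :
    D.descProd k l * (D.descProd (k + 1) l * D.T (k + 1)) =
      D.T (k + l + 1) * (D.descProd k l * D.descProd (k + 1) l) := by
  rw [← descProd_succ', ← D.descProd_mul_descProd_shift le_rfl (by omega) (by omega),
    descProd_succ, mul_assoc]

theorem E_T_T_ascSum_ascSum (m k : ℕ) (h : k + m + 3 = n) :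
    D.E (k + 1) * (D.T (k + 2) * D.T (k + 1)) * (D.ascSum m (k + 3) * D.ascSum (m + 2) (k + 1)) =
      D.E (k + 1) * (D.ascSum m (k + 3) * D.ascSum (m + 1) (k + 2)) +
        D.E (k + 1) * (D.T (k + 2) * D.T (k + 1)) *
          (D.ascSum m (k + 3) + (q ^ 2 - 1) • D.arcSum (m + 2) 1 (k + 1)) := by
  have hq := D.hq
  have x1 : D.E (k + 1) * (D.T (k + 2) * D.T (k + 1)) = D.E (k + 1) * D.E (k + 2) :=
    D.E_T_T' (by omega) (by omega)
  have x2 : D.E (k + 1) * D.E (k + 2) * D.T (k + 1) = D.E (k + 1) * D.Tinv (k + 2) := by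
    rw [D.Tinv_eq (by omega) (by omega)]
    exact D.E_E_T (by omega) (by omega)
  have c : D.T (k + 1) * D.ascSum m (k + 3) = D.ascSum m (k + 3) * D.T (k + 1) :=
    (commute_ascSum fun j _ _ => D.commute_T_T (by omega) (by omega) (by omega)).eq
  have x3 : (1 + q • D.T (k + 2)) * D.arcSum (m + 2) 1 (k + 1) =
      D.ascSum m (k + 3) * D.ascSum (m + 1) (k + 2) :=
    D.one_add_mul_arcSum_one m (k + 1) (by omega)
  have x4 : q • (D.Tinv (k + 2) * (1 + q • D.T (k + 2))) =
      1 + q • D.T (k + 2) + (q ^ 2 - 1) • D.E (k + 2) := by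
    rw [mul_add, mul_smul_comm, D.Tinv_mul_T _ (by omega) (by omega), mul_one,
      D.Tinv_eq (by omega) (by omega)]
    match_scalars <;> (field_simp)
    all_goals ring
  have s : D.ascSum (m + 2) (k + 1) = 1 + q • (D.T (k + 1) * D.ascSum (m + 1) (k + 2)) := rfl
  rw [s, x1]
  calc _ = D.E (k + 1) * D.E (k + 2) * D.ascSum m (k + 3) +
        q • (D.E (k + 1) * D.E (k + 2) * (D.ascSum m (k + 3) * D.T (k + 1)) *
          D.ascSum (m + 1) (k + 2)) := by
        simp only [mul_add, mul_one, mul_smul_comm, mul_assoc]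
    _ = D.E (k + 1) * D.E (k + 2) * D.ascSum m (k + 3) +
        q • (D.E (k + 1) * D.E (k + 2) * D.T (k + 1) *
          (D.ascSum m (k + 3) * D.ascSum (m + 1) (k + 2))) := by
        rw [← c]; simp only [mul_assoc]
    _ = D.E (k + 1) * D.E (k + 2) * D.ascSum m (k + 3) +
        D.E (k + 1) * (q • (D.Tinv (k + 2) * (1 + q • D.T (k + 2)))) *
          D.arcSum (m + 2) 1 (k + 1) := by
        rw [x2, ← x3]; simp only [mul_assoc, mul_smul_comm, smul_mul_assoc]
    _ = _ := by
        rw [x4, ← x3]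
        simp only [mul_add, add_mul, mul_assoc, mul_smul_comm, smul_mul_assoc]
        abel

/-- Choosing a first arc and then the others counts every arc pattern `f` times
(here `f = g + 1`). -/
def FirstArc (D : BMWData F A n q r) (g : ℕ) : Prop :=
  ∀ {m k : ℕ}, k + m + 2 = n →
    D.cupProd k (g + 1) * (D.arcSum m g (k + 2) * D.arcSum (m + 2) 1 k) =
      qint q (g + 1) • (D.cupProd k (g + 1) * D.arcSum (m + 2) (g + 1) k)

/-- A free strand can be pulled across `f` arcs. -/
def FreeStrand (D : BMWData F A n q r) (f : ℕ) : Prop :=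
  ∀ {p m k a : ℕ}, m = 2 * f + p → k + m + 1 = n → a = k + 2 * f + 1 →
    D.cupProd k f * (D.descProd k (2 * f) * (D.arcSum m f (k + 1) * D.ascSum m (k + 1))) =
      D.cupProd k f * (D.ascSum p a * D.arcSum (m + 1) f k)

theorem firstArc_zero : D.FirstArc 0 := by
  intro m k _
  simp

theorem freeStrand_zero : D.FreeStrand 0 := by
  rintro p m k a rfl _ rfl
  simp

variable {D}

theorem cupProd_mul_descProd {k f : ℕ} (h : k + 2 * f < n) :
    D.cupProd k f * D.descProd k (2 * f) = D.descProd k (2 * f) * D.cupProd (k + 1) f :=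
  (D.descProd_mul_cupProd le_rfl le_rfl h).symm

theorem freeStrand_succ_aux {g p k : ℕ} (hg : D.FreeStrand g) (hI : D.FirstArc g)
    (hk : k + 2 * g + p + 3 = n)
    (hX : D.cupProd k (g + 1) * (D.descProd k (2 * g + 2) * (D.descProd (k + 1) (2 * g + 2) *
        (D.arcSum (2 * g + p + 1) (g + 1) (k + 2) * D.ascSum (2 * g + p + 2) (k + 1)))) =
      D.cupProd k (g + 1) * (D.descProd k (2 * g + 2) * (D.descProd (k + 1) (2 * g + 2) *
        D.arcSum (2 * g + p + 1) (g + 1) (k + 2))) +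
      D.cupProd k (g + 1) * ((D.ascSum p (k + 2 * g + 3) - 1) * (D.descProd k (2 * g + 2) *
        D.arcSum (2 * g + p + 2) (g + 1) (k + 1)))) :
    D.cupProd k (g + 1) * (D.descProd k (2 * g + 2) *
        (D.arcSum (2 * g + p + 2) (g + 1) (k + 1) * D.ascSum (2 * g + p + 2) (k + 1))) =
      D.cupProd k (g + 1) * (D.ascSum p (k + 2 * g + 3) *
        D.arcSum (2 * g + p + 3) (g + 1) k) := by
  have F1 : D.descProd k (2 * g + 2) =
      D.descProd (k + 2) (2 * g) * (D.T (k + 2) * D.T (k + 1)) := descProd_add_two ..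
  have F2 : D.arcSum (2 * g + p + 2) (g + 1) (k + 1) =
      D.arcSum (2 * g + p) g (k + 3) * D.ascSum (2 * g + p) (k + 3) + q ^ (2 * g + 2) •
        (D.descProd (k + 1) (2 * g + 2) * D.arcSum (2 * g + p + 1) (g + 1) (k + 2)) :=
    arcSum_succ ..
  have F3 := D.E_T_T_ascSum_ascSum (2 * g + p) k (by omega)
  have F5 : D.cupProd (k + 2) g * (D.descProd (k + 2) (2 * g) *
        (D.arcSum (2 * g + p) g (k + 3) * D.ascSum (2 * g + p) (k + 3))) =
      D.cupProd (k + 2) g *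
        (D.ascSum p (k + 2 * g + 3) * D.arcSum (2 * g + p + 1) g (k + 2)) :=
    hg rfl (by omega) (by omega)
  have F6 : D.cupProd (k + 1) (g + 1) *
        (D.arcSum (2 * g + p) g (k + 3) * D.arcSum (2 * g + p + 2) 1 (k + 1)) =
      qint q (g + 1) • (D.cupProd (k + 1) (g + 1) *
        D.arcSum (2 * g + p + 2) (g + 1) (k + 1)) :=
    hI (by omega)
  have F7 : D.cupProd k (g + 1) * D.descProd k (2 * g + 2) =
      D.descProd k (2 * g + 2) * D.cupProd (k + 1) (g + 1) :=
    cupProd_mul_descProd (by omega)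
  have F9 : D.arcSum (2 * g + p + 3) (g + 1) k =
      D.arcSum (2 * g + p + 1) g (k + 2) * D.ascSum (2 * g + p + 1) (k + 2) +
        q ^ (2 * g + 2) • (D.descProd k (2 * g + 2) *
          D.arcSum (2 * g + p + 2) (g + 1) (k + 1)) :=
    arcSum_succ ..
  have F6' : D.cupProd k (g + 1) * (D.descProd k (2 * g + 2) *
        (D.arcSum (2 * g + p) g (k + 3) * D.arcSum (2 * g + p + 2) 1 (k + 1))) =
      qint q (g + 1) • (D.cupProd k (g + 1) * (D.descProd k (2 * g + 2) *
        D.arcSum (2 * g + p + 2) (g + 1) (k + 1))) := by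
    rw [← mul_assoc, F7, mul_assoc, F6, ← mul_assoc (D.cupProd k _), F7, mul_smul_comm,
      mul_assoc]
  have C1 : Commute (D.E (k + 1)) (D.cupProd (k + 2) g) := commute_cupProd fun j _ _ =>
    D.commute_E_E (by omega) (by omega) (by omega)
  have C2 : Commute (D.E (k + 1)) (D.descProd (k + 2) (2 * g)) := commute_descProd fun j _ _ =>
    D.commute_E_T (by omega) (by omega) (by omega)
  have C3 : Commute (D.E (k + 1)) (D.arcSum (2 * g + p) g (k + 3)) := commute_arcSum fun j _ _ =>
    D.commute_E_T (by omega) (by omega) (by omega)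
  have C4 : Commute (D.T (k + 2) * D.T (k + 1)) (D.arcSum (2 * g + p) g (k + 3)) :=
    (commute_arcSum fun j _ _ => D.commute_T_T (by omega) (by omega) (by omega)).mul_left
      (commute_arcSum fun j _ _ => D.commute_T_T (by omega) (by omega) (by omega))
  have Q : (q ^ 2 - 1) * qint q (g + 1) = q ^ (2 * g + 2) - 1 := qint_mul q (g + 1)
  have hc : D.cupProd k (g + 1) = D.E (k + 1) * D.cupProd (k + 2) g := rfl
  have L : D.cupProd k (g + 1) * (D.descProd k (2 * g + 2) *
      (D.arcSum (2 * g + p) g (k + 3) *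
        (D.ascSum (2 * g + p) (k + 3) * D.ascSum (2 * g + p + 2) (k + 1)))) =
      D.cupProd k (g + 1) * (D.ascSum p (k + 2 * g + 3) *
        (D.arcSum (2 * g + p + 1) g (k + 2) * D.ascSum (2 * g + p + 1) (k + 2))) +
      D.cupProd k (g + 1) * (D.descProd k (2 * g + 2) *
        (D.arcSum (2 * g + p) g (k + 3) * D.ascSum (2 * g + p) (k + 3))) +
      (q ^ 2 - 1) • (D.cupProd k (g + 1) * (D.descProd k (2 * g + 2) *
        (D.arcSum (2 * g + p) g (k + 3) * D.arcSum (2 * g + p + 2) 1 (k + 1)))) := by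
    clear hX F6 F6' F7 F2 F9
    rw [hc, F1]
    generalize D.T (k + 2) * D.T (k + 1) = t at *
    generalize D.arcSum (2 * g + p) g (k + 3) = x at *
    have M : ∀ y, D.E (k + 1) * D.cupProd (k + 2) g *
        (D.descProd (k + 2) (2 * g) * t * (x * y)) =
        D.cupProd (k + 2) g * (D.descProd (k + 2) (2 * g) * (x * (D.E (k + 1) * t * y))) := by
      intro y
      rw [← mul_assoc x (_ * _), ← mul_assoc x, ← C3.eq, mul_assoc (D.E (k + 1)) x, ← C4.eq, C1.eq]
      simp only [mul_assoc]
      rw [← mul_assoc (D.E _) (D.descProd _ _), C2.eq, mul_assoc]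
    rw [M, M, M, F3]
    have N : D.cupProd (k + 2) g * (D.descProd (k + 2) (2 * g) * (x * (D.E (k + 1) *
        (D.ascSum (2 * g + p) (k + 3) * D.ascSum (2 * g + p + 1) (k + 2))))) =
        D.E (k + 1) * (D.cupProd (k + 2) g * (D.descProd (k + 2) (2 * g) *
          (x * D.ascSum (2 * g + p) (k + 3)))) * D.ascSum (2 * g + p + 1) (k + 2) := by
      rw [← mul_assoc (D.E _) (D.cupProd _ _), C1.eq, mul_assoc (D.cupProd _ _) (D.E _),
        ← mul_assoc (D.E _) (D.descProd _ _), C2.eq, mul_assoc (D.descProd _ _) (D.E _),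
        ← mul_assoc (D.E _) x, C3.eq]
      simp only [mul_assoc]
    rw [mul_add, mul_add, mul_add, N, F5]
    simp only [mul_add, mul_smul_comm, mul_assoc]
    abel
  nth_rw 1 [F2]
  rw [F9]
  simp only [add_mul, mul_add, smul_mul_assoc, mul_smul_comm, mul_assoc]
  rw [L, hX, F6', smul_smul, Q, F2]
  simp only [sub_mul, one_mul, mul_sub, mul_add, mul_smul_comm]
  match_scalars <;> ring

theorem FreeStrand.succ {g : ℕ} (hg : D.FreeStrand g) (hI : D.FirstArc g) :
    D.FreeStrand (g + 1) := by
  intro p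
  induction p with
  | zero =>
    rintro m k a rfl hk rfl
    refine freeStrand_succ_aux (p := 0) hg hI (by omega) ?_
    rw [arcSum_eq_zero _ _ (by omega : 2 * g + 0 + 1 < 2 * (g + 1))]
    simp
  | succ p ih =>
    rintro m k a rfl hk rfl
    rw [(by omega : 2 * (g + 1) + (p + 1) = 2 * g + (p + 1) + 2),
      (by omega : k + 2 * (g + 1) + 1 = k + 2 * g + 3)]
    refine freeStrand_succ_aux (p := p + 1) hg hI (by omega) ?_
    have ih' : D.cupProd (k + 1) (g + 1) * (D.descProd (k + 1) (2 * g + 2) *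
          (D.arcSum (2 * g + p + 2) (g + 1) (k + 2) * D.ascSum (2 * g + p + 2) (k + 2))) =
        D.cupProd (k + 1) (g + 1) * (D.ascSum p (k + 2 * g + 4) *
          D.arcSum (2 * g + p + 3) (g + 1) (k + 1)) :=
      ih (by omega) (by omega) (by omega)
    have F7 : D.cupProd k (g + 1) * D.descProd k (2 * g + 2) =
        D.descProd k (2 * g + 2) * D.cupProd (k + 1) (g + 1) :=
      cupProd_mul_descProd (by omega)
    have B : D.descProd k (2 * g + 2) * (D.descProd (k + 1) (2 * g + 2) * D.T (k + 1)) =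
        D.T (k + 2 * g + 3) * (D.descProd k (2 * g + 2) * D.descProd (k + 1) (2 * g + 2)) :=
      D.descProd_mul_descProd_mul_T k (2 * g + 2) (by omega)
    have C1 : Commute (D.T (k + 1)) (D.arcSum (2 * g + p + 2) (g + 1) (k + 2)) :=
      commute_arcSum fun j _ _ => D.commute_T_T (by omega) (by omega) (by omega)
    have C2 : Commute (D.T (k + 2 * g + 3)) (D.cupProd k (g + 1)) :=
      commute_cupProd fun j _ _ => (D.commute_E_T (by omega) (by omega) (by omega)).symm
    have C3 : Commute (D.descProd k (2 * g + 2)) (D.ascSum p (k + 2 * g + 4)) :=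
      commute_ascSum fun j _ _ => (commute_descProd fun i _ _ =>
        (D.commute_T_T (by omega) (by omega) (by omega)).symm).symm
    have s1 : D.ascSum (2 * g + (p + 1) + 2) (k + 1) =
        1 + q • (D.T (k + 1) * D.ascSum (2 * g + p + 2) (k + 2)) := rfl
    have s2 : D.ascSum (p + 1) (k + 2 * g + 3) - 1 =
        q • (D.T (k + 2 * g + 3) * D.ascSum p (k + 2 * g + 4)) := add_sub_cancel_left _ _
    rw [s1, s2]
    simp only [mul_add, mul_one, mul_smul_comm, smul_mul_assoc]
    congr 2
    rw [(by omega : 2 * g + (p + 1) + 1 = 2 * g + p + 2),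
      (by omega : 2 * g + (p + 1) + 2 = 2 * g + p + 3)]
    generalize D.arcSum (2 * g + p + 2) (g + 1) (k + 2) = x at *
    calc _ = D.cupProd k (g + 1) * (D.descProd k (2 * g + 2) *
            (D.descProd (k + 1) (2 * g + 2) * D.T (k + 1)) *
            (x * D.ascSum (2 * g + p + 2) (k + 2))) := by
          rw [← mul_assoc x, ← C1.eq]; simp only [mul_assoc]
      _ = D.T (k + 2 * g + 3) * (D.cupProd k (g + 1) * D.descProd k (2 * g + 2) *
            (D.descProd (k + 1) (2 * g + 2) * (x * D.ascSum (2 * g + p + 2) (k + 2)))) := by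
          rw [B]; simp only [← mul_assoc]; rw [C2.eq]
      _ = D.T (k + 2 * g + 3) * (D.cupProd k (g + 1) * D.descProd k (2 * g + 2) *
            (D.ascSum p (k + 2 * g + 4) * D.arcSum (2 * g + p + 3) (g + 1) (k + 1))) := by
          rw [F7, mul_assoc (D.descProd k _), ih']; simp only [mul_assoc]
      _ = _ := by
          rw [mul_assoc (D.cupProd _ _), ← mul_assoc (D.descProd _ _), C3.eq, ← mul_assoc, C2.eq]
          simp only [mul_assoc]

theorem freeStrand_one : D.FreeStrand 1 :=
  FreeStrand.succ D.freeStrand_zero D.firstArc_zero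

end BMWData

end Identities

section Counting

variable {F : Type*} [Field F] {A : Type*} [Ring A] [Algebra F A] {n : ℕ} {q r : F}

namespace BMWData

variable {D : BMWData F A n q r}

theorem E_E_ascSum_arcSum_one (m k : ℕ) (h : k + m + 4 = n) :
    D.E (k + 1) * (D.E (k + 3) * (D.ascSum m (k + 4) * (D.T (k + 2) * (D.T (k + 1) *
        D.arcSum (m + 3) 1 (k + 1))))) =
      D.E (k + 1) * (D.E (k + 3) * (D.arcSum (m + 2) 1 (k + 2) * D.ascSum (m + 2) (k + 2))) := by
  have hF : D.E (k + 2) * (D.T (k + 3) * D.T (k + 2) *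
        (D.arcSum (m + 2) 1 (k + 2) * D.ascSum (m + 2) (k + 2))) =
      D.E (k + 2) * (D.ascSum m (k + 4) * D.arcSum (m + 3) 1 (k + 1)) := by
    have := D.freeStrand_one (p := m) (m := m + 2) (k := k + 1) (by omega) (by omega) rfl
    simpa [cupProd_succ, descProd_succ, mul_assoc] using this
  have C : Commute (D.T (k + 2) * D.T (k + 1)) (D.ascSum m (k + 4)) :=
    (commute_ascSum fun j _ _ => D.commute_T_T (by omega) (by omega) (by omega)).mul_left
      (commute_ascSum fun j _ _ => D.commute_T_T (by omega) (by omega) (by omega))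
  have CE := (D.commute_E_E (by omega : 1 ≤ k + 1) (by omega : k + 1 + 1 < k + 3) (by omega)).eq
  have e1 : D.E (k + 1) * (D.T (k + 2) * D.T (k + 1)) = D.E (k + 1) * D.E (k + 2) :=
    D.E_T_T' (by omega) (by omega)
  have e2 : D.E (k + 2) * (D.T (k + 3) * D.T (k + 2)) = D.E (k + 2) * D.E (k + 3) :=
    D.E_T_T' (by omega) (by omega)
  have e3 : D.E (k + 3) * D.E (k + 2) * D.E (k + 3) = D.E (k + 3) :=
    D.EEE₂ (k + 2) (by omega) (by omega)
  calc _ = D.E (k + 1) * D.E (k + 3) * (D.ascSum m (k + 4) * (D.T (k + 2) * D.T (k + 1))) *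
        D.arcSum (m + 3) 1 (k + 1) := by simp only [mul_assoc]
    _ = D.E (k + 3) * (D.E (k + 1) * (D.T (k + 2) * D.T (k + 1))) * (D.ascSum m (k + 4) *
        D.arcSum (m + 3) 1 (k + 1)) := by rw [← C.eq, CE]; simp only [mul_assoc]
    _ = D.E (k + 1) * D.E (k + 3) * (D.E (k + 2) * (D.ascSum m (k + 4) *
        D.arcSum (m + 3) 1 (k + 1))) := by rw [e1, CE]; simp only [mul_assoc]
    _ = D.E (k + 1) * (D.E (k + 3) * (D.E (k + 2) * (D.T (k + 3) * D.T (k + 2)))) *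
        (D.arcSum (m + 2) 1 (k + 2) * D.ascSum (m + 2) (k + 2)) := by
      rw [← hF]; simp only [mul_assoc]
    _ = _ := by rw [e2, ← mul_assoc (D.E (k + 3)), e3]; simp only [mul_assoc]

theorem firstArc_succ_aux {g p k : ℕ} (hI : D.FirstArc g) (hk : k + 2 * g + p + 4 = n)
    (hX : D.cupProd k (g + 2) * (D.descProd k (2 * g + 4) *
        (D.arcSum (2 * g + p + 1) (g + 1) (k + 3) * D.arcSum (2 * g + p + 3) 1 (k + 1))) =
      qint q (g + 2) • (D.cupProd k (g + 2) * (D.descProd k (2 * g + 4) *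
        D.arcSum (2 * g + p + 3) (g + 2) (k + 1)))) :
    D.cupProd k (g + 2) * (D.arcSum (2 * g + p + 2) (g + 1) (k + 2) *
        D.arcSum (2 * g + p + 4) 1 k) =
      qint q (g + 2) • (D.cupProd k (g + 2) * D.arcSum (2 * g + p + 4) (g + 2) k) := by
  have F1 : D.arcSum (2 * g + p + 2) (g + 1) (k + 2) =
      D.arcSum (2 * g + p) g (k + 4) * D.ascSum (2 * g + p) (k + 4) + q ^ (2 * g + 2) •
        (D.descProd (k + 2) (2 * g + 2) * D.arcSum (2 * g + p + 1) (g + 1) (k + 3)) :=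
    arcSum_succ ..
  have F2 : D.arcSum (2 * g + p + 4) 1 k = D.ascSum (2 * g + p + 2) (k + 2) +
      q ^ 2 • (D.T (k + 2) * (D.T (k + 1) * D.arcSum (2 * g + p + 3) 1 (k + 1))) :=
    arcSum_one_succ ..
  have F3 : D.arcSum (2 * g + p + 4) (g + 2) k =
      D.arcSum (2 * g + p + 2) (g + 1) (k + 2) * D.ascSum (2 * g + p + 2) (k + 2) +
        q ^ (2 * g + 4) • (D.descProd k (2 * g + 4) * D.arcSum (2 * g + p + 3) (g + 2) (k + 1)) :=
    arcSum_succ ..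
  have F4 : D.descProd k (2 * g + 4) =
      D.descProd (k + 2) (2 * g + 2) * (D.T (k + 2) * D.T (k + 1)) := descProd_add_two ..
  have F5 : D.cupProd (k + 2) (g + 1) *
        (D.arcSum (2 * g + p) g (k + 4) * D.arcSum (2 * g + p + 2) 1 (k + 2)) =
      qint q (g + 1) • (D.cupProd (k + 2) (g + 1) * D.arcSum (2 * g + p + 2) (g + 1) (k + 2)) :=
    hI (by omega)
  have F6 := D.E_E_ascSum_arcSum_one (2 * g + p) k (by omega)
  have C1 : Commute (D.T (k + 2) * D.T (k + 1)) (D.arcSum (2 * g + p + 1) (g + 1) (k + 3)) :=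
    (commute_arcSum fun j _ _ => D.commute_T_T (by omega) (by omega) (by omega)).mul_left
      (commute_arcSum fun j _ _ => D.commute_T_T (by omega) (by omega) (by omega))
  have C2 : Commute (D.E (k + 1) * D.E (k + 3))
      (D.cupProd (k + 4) g * D.arcSum (2 * g + p) g (k + 4)) :=
    ((commute_cupProd fun j _ _ => D.commute_E_E (by omega) (by omega) (by omega)).mul_left
      (commute_cupProd fun j _ _ => D.commute_E_E (by omega) (by omega) (by omega))).mul_right
    ((commute_arcSum fun j _ _ => D.commute_E_T (by omega) (by omega) (by omega)).mul_left
      (commute_arcSum fun j _ _ => D.commute_E_T (by omega) (by omega) (by omega)))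
  have hc : D.cupProd k (g + 2) = D.E (k + 1) * D.cupProd (k + 2) (g + 1) := rfl
  have hc' : D.cupProd (k + 2) (g + 1) = D.E (k + 3) * D.cupProd (k + 4) g := rfl
  have La : D.cupProd k (g + 2) * (D.arcSum (2 * g + p) g (k + 4) *
      (D.ascSum (2 * g + p) (k + 4) *
        (D.T (k + 2) * (D.T (k + 1) * D.arcSum (2 * g + p + 3) 1 (k + 1))))) =
      qint q (g + 1) • (D.cupProd k (g + 2) * (D.arcSum (2 * g + p + 2) (g + 1) (k + 2) *
        D.ascSum (2 * g + p + 2) (k + 2))) := by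
    have M : ∀ y, D.E (k + 1) * (D.E (k + 3) * D.cupProd (k + 4) g) *
        (D.arcSum (2 * g + p) g (k + 4) * y) =
        D.cupProd (k + 4) g * D.arcSum (2 * g + p) g (k + 4) *
          (D.E (k + 1) * (D.E (k + 3) * y)) := by
      intro y
      have := congrArg (· * y) C2.eq
      simpa only [mul_assoc] using this
    have F5' := congrArg (fun x => D.E (k + 1) * x * D.ascSum (2 * g + p + 2) (k + 2)) F5
    rw [hc, hc', M, F6, ← M, ← hc', mul_smul_comm, smul_mul_assoc] at *
    simpa only [mul_assoc, mul_smul_comm, smul_mul_assoc] using F5'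
  have Lb : D.cupProd k (g + 2) * (D.descProd (k + 2) (2 * g + 2) *
      (D.arcSum (2 * g + p + 1) (g + 1) (k + 3) *
        (D.T (k + 2) * (D.T (k + 1) * D.arcSum (2 * g + p + 3) 1 (k + 1))))) =
      qint q (g + 2) • (D.cupProd k (g + 2) * (D.descProd k (2 * g + 4) *
        D.arcSum (2 * g + p + 3) (g + 2) (k + 1))) := by
    rw [← hX, F4, ← mul_assoc (D.T (k + 2)), ← mul_assoc (D.arcSum (2 * g + p + 1) _ _), ← C1.eq]
    simp only [mul_assoc]
  rw [F2, F3, mul_add, mul_smul_comm]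
  nth_rw 2 [F1]
  simp only [add_mul, mul_add, smul_mul_assoc, mul_smul_comm, mul_assoc, smul_add]
  rw [La, Lb, qint_succ' q (g + 1)]
  match_scalars <;> ring

theorem firstArc (g : ℕ) : D.FirstArc g := by
  induction g with
  | zero => exact firstArc_zero D
  | succ g hI =>
    intro m
    induction m with
    | zero =>
      intro k _
      rw [arcSum_eq_zero _ _ (by omega : 0 < 2 * (g + 1)),
        arcSum_eq_zero _ _ (by omega : 0 + 2 < 2 * (g + 1 + 1))]
      simp
    | succ m ih =>
      intro k hk
      rcases lt_or_ge (m + 1) (2 * (g + 1)) with hm | hm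
      · rw [arcSum_eq_zero _ _ hm,
          arcSum_eq_zero _ _ (by omega : m + 1 + 2 < 2 * (g + 1 + 1))]
        simp
      obtain ⟨p, hp⟩ : ∃ p, m + 1 = 2 * g + p + 2 := ⟨m - 2 * g - 1, by omega⟩
      obtain rfl : m = 2 * g + p + 1 := by omega
      refine firstArc_succ_aux hI (by omega) ?_
      rcases Nat.eq_zero_or_pos p with rfl | hp0
      · rw [arcSum_eq_zero _ _ (by omega : 2 * g + 0 + 1 < 2 * (g + 1)),
          arcSum_eq_zero _ _ (by omega : 2 * g + 0 + 3 < 2 * (g + 2))]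
        simp
      have F7 : D.cupProd k (g + 2) * D.descProd k (2 * g + 4) =
          D.descProd k (2 * g + 4) * D.cupProd (k + 1) (g + 2) :=
        cupProd_mul_descProd (by omega)
      have ih' : D.cupProd (k + 1) (g + 2) * (D.arcSum (2 * g + p + 1) (g + 1) (k + 3) *
            D.arcSum (2 * g + p + 3) 1 (k + 1)) =
          qint q (g + 2) • (D.cupProd (k + 1) (g + 2) *
            D.arcSum (2 * g + p + 3) (g + 2) (k + 1)) :=
        ih (by omega)
      rw [← mul_assoc, ← mul_assoc (D.cupProd k _), F7, mul_assoc, ih', mul_smul_comm, mul_assoc]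

theorem freeStrand (f : ℕ) : D.FreeStrand f := by
  induction f with
  | zero => exact freeStrand_zero D
  | succ f ih => exact ih.succ (firstArc f)

end BMWData

end Counting

section LastArc

variable {F : Type*} [Field F] {A : Type*} [Ring A] [Algebra F A] {n : ℕ} {q r : F}

namespace BMWData

variable {D : BMWData F A n q r}

theorem cupProd_mul_descProd_arcSum (f p k : ℕ) (h : k + 2 * f + p + 2 = n) :
    D.cupProd k (f + 1) * (D.descProd k (2 * f) * (D.ascSum p (k + 2 * f + 2) *
        D.arcSum (2 * f + p + 1) f (k + 1))) =
      D.cupProd k (f + 1) *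
        (D.arcSum (2 * f + p) f (k + 2) * D.ascSum (2 * f + p) (k + 2)) := by
  have h1 : D.cupProd (k + 1) f * (D.descProd (k + 1) (2 * f) *
        (D.arcSum (2 * f + p) f (k + 2) * D.ascSum (2 * f + p) (k + 2))) =
      D.cupProd (k + 1) f * (D.ascSum p (k + 2 * f + 2) *
        D.arcSum (2 * f + p + 1) f (k + 1)) :=
    D.freeStrand f rfl (by omega) (by omega)
  have h2 : D.cupProd k f * D.descProd k (2 * f) =
      D.descProd k (2 * f) * D.cupProd (k + 1) f :=
    cupProd_mul_descProd (by omega)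
  have h3 := D.cupProd_mul_descProd_mul_descProd k f (by omega)
  have h4 : Commute (D.E (k + 2 * f + 1)) (D.cupProd k f) := commute_cupProd fun j _ _ =>
    (D.commute_E_E (by omega) (by omega) (by omega)).symm
  rw [cupProd_succ', ← h4.eq] at *
  calc _ = D.E (k + 2 * f + 1) * (D.cupProd k f * D.descProd k (2 * f)) *
        (D.ascSum p (k + 2 * f + 2) * D.arcSum (2 * f + p + 1) f (k + 1)) := by
        simp only [mul_assoc]
    _ = D.E (k + 2 * f + 1) * D.descProd k (2 * f) * (D.cupProd (k + 1) f *
        (D.ascSum p (k + 2 * f + 2) * D.arcSum (2 * f + p + 1) f (k + 1))) := by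
        rw [h2]; simp only [mul_assoc]
    _ = D.E (k + 2 * f + 1) * (D.descProd k (2 * f) * D.cupProd (k + 1) f) *
        (D.descProd (k + 1) (2 * f) *
          (D.arcSum (2 * f + p) f (k + 2) * D.ascSum (2 * f + p) (k + 2))) := by
        rw [← h1]; simp only [mul_assoc]
    _ = D.E (k + 2 * f + 1) * D.cupProd k f *
        (D.descProd k (2 * f) * D.descProd (k + 1) (2 * f)) *
          (D.arcSum (2 * f + p) f (k + 2) * D.ascSum (2 * f + p) (k + 2)) := by
        rw [← h2]; simp only [mul_assoc]
    _ = _ := by rw [h3]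

/-- Choosing the first arcs and then a last one counts every arc pattern `g + 1` times. -/
theorem lastArc {g p k : ℕ} (hk : k + 2 * g + p = n) :
    D.cupProd k (g + 1) * (D.arcSum p 1 (k + 2 * g) * D.arcSum (2 * g + p) g k) =
      qint q (g + 1) • (D.cupProd k (g + 1) * D.arcSum (2 * g + p) (g + 1) k) := by
  induction g generalizing p k with
  | zero => simp
  | succ g ihg =>
    induction p using Nat.strong_induction_on generalizing k with
    | _ p ihp =>
    rcases lt_or_ge p 2 with hp | hp
    · rw [arcSum_eq_zero _ _ (by omega : p < 2 * 1),
        arcSum_eq_zero _ _ (by omega : 2 * (g + 1) + p < 2 * (g + 1 + 1))]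
      simp
    obtain ⟨p, rfl⟩ : ∃ p', p = p' + 2 := ⟨p - 2, by omega⟩
    rw [(by omega : k + 2 * (g + 1) = k + 2 * g + 2),
      (by omega : 2 * (g + 1) + (p + 2) = 2 * g + p + 4)]
    have F1 : D.arcSum (2 * g + p + 4) (g + 1) k =
        D.arcSum (2 * g + p + 2) g (k + 2) * D.ascSum (2 * g + p + 2) (k + 2) +
          q ^ (2 * g + 2) • (D.descProd k (2 * g + 2) *
            D.arcSum (2 * g + p + 3) (g + 1) (k + 1)) :=
      arcSum_succ ..
    have F2 : D.arcSum (2 * g + p + 4) (g + 1 + 1) k =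
        D.arcSum (2 * g + p + 2) (g + 1) (k + 2) * D.ascSum (2 * g + p + 2) (k + 2) +
          q ^ (2 * g + 4) • (D.descProd k (2 * g + 4) *
            D.arcSum (2 * g + p + 3) (g + 2) (k + 1)) :=
      arcSum_succ ..
    have F3 : D.arcSum (p + 2) 1 (k + 2 * g + 2) = D.ascSum p (k + 2 * g + 4) +
        q ^ 2 • (D.T (k + 2 * g + 4) * (D.T (k + 2 * g + 3) *
          D.arcSum (p + 1) 1 (k + 2 * g + 3))) :=
      arcSum_one_succ ..
    have F4 : D.cupProd (k + 2) (g + 1) *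
          (D.arcSum (p + 2) 1 (k + 2 * g + 2) * D.arcSum (2 * g + p + 2) g (k + 2)) =
        qint q (g + 1) • (D.cupProd (k + 2) (g + 1) *
          D.arcSum (2 * g + p + 2) (g + 1) (k + 2)) := by
      have := ihg (p := p + 2) (k := k + 2) (by omega)
      rwa [(by omega : k + 2 + 2 * g = k + 2 * g + 2)] at this
    have F5 : D.cupProd k (g + 1 + 1) * (D.descProd k (2 * g + 2) *
          (D.ascSum p (k + 2 * g + 4) * D.arcSum (2 * g + p + 3) (g + 1) (k + 1))) =
        D.cupProd k (g + 1 + 1) * (D.arcSum (2 * g + p + 2) (g + 1) (k + 2) *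
          D.ascSum (2 * g + p + 2) (k + 2)) := by
      have := D.cupProd_mul_descProd_arcSum (g + 1) p k (by omega)
      rwa [(by omega : k + 2 * (g + 1) + 2 = k + 2 * g + 4),
        (by omega : 2 * (g + 1) + p + 1 = 2 * g + p + 3),
        (by omega : 2 * (g + 1) + p = 2 * g + p + 2)] at this
    have C1 : Commute (D.descProd k (2 * g + 2)) (D.ascSum p (k + 2 * g + 4)) :=
      commute_ascSum fun j _ _ => (commute_descProd fun i _ _ =>
        (D.commute_T_T (by omega) (by omega) (by omega)).symm).symm
    have C2 : Commute (D.descProd k (2 * g + 2)) (D.arcSum (p + 1) 1 (k + 2 * g + 3)) :=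
      commute_arcSum fun j _ _ => (commute_descProd fun i _ _ =>
        (D.commute_T_T (by omega) (by omega) (by omega)).symm).symm
    have F6 : D.descProd k (2 * g + 4) =
        D.T (k + 2 * g + 4) * (D.T (k + 2 * g + 3) * D.descProd k (2 * g + 2)) := rfl
    have hc : D.cupProd k (g + 1 + 1) = D.E (k + 1) * D.cupProd (k + 2) (g + 1) := rfl
    have L : D.cupProd k (g + 1 + 1) * (D.descProd k (2 * g + 4) *
          (D.arcSum (p + 1) 1 (k + 2 * g + 3) * D.arcSum (2 * g + p + 3) (g + 1) (k + 1))) =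
        qint q (g + 1 + 1) • (D.cupProd k (g + 1 + 1) * (D.descProd k (2 * g + 4) *
          D.arcSum (2 * g + p + 3) (g + 2) (k + 1))) := by
      rcases Nat.eq_zero_or_pos p with rfl | hp0
      · rw [arcSum_eq_zero _ _ (by omega : 0 + 1 < 2 * 1),
          arcSum_eq_zero _ _ (by omega : 2 * g + 0 + 3 < 2 * (g + 2))]
        simp
      have F7 : D.cupProd k (g + 1 + 1) * D.descProd k (2 * g + 4) =
          D.descProd k (2 * g + 4) * D.cupProd (k + 1) (g + 1 + 1) :=
        cupProd_mul_descProd (by omega)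
      have ih' := ihp (p + 1) (by omega) (k := k + 1) (by omega)
      rw [(by omega : k + 1 + 2 * (g + 1) = k + 2 * g + 3),
        (by omega : 2 * (g + 1) + (p + 1) = 2 * g + p + 3)] at ih'
      rw [← mul_assoc, ← mul_assoc (D.cupProd k _), F7, mul_assoc, ih', mul_smul_comm, mul_assoc]
    have F4' := congrArg (fun x => D.E (k + 1) * x * D.ascSum (2 * g + p + 2) (k + 2)) F4
    simp only [mul_smul_comm, smul_mul_assoc, ← mul_assoc, ← hc] at F4'
    have L' : D.cupProd k (g + 1 + 1) * (D.arcSum (p + 2) 1 (k + 2 * g + 2) *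
          (D.descProd k (2 * g + 2) * D.arcSum (2 * g + p + 3) (g + 1) (k + 1))) =
        D.cupProd k (g + 1 + 1) * (D.arcSum (2 * g + p + 2) (g + 1) (k + 2) *
          D.ascSum (2 * g + p + 2) (k + 2)) +
        (q ^ 2 * qint q (g + 1 + 1)) • (D.cupProd k (g + 1 + 1) * (D.descProd k (2 * g + 4) *
          D.arcSum (2 * g + p + 3) (g + 2) (k + 1))) := by
      rw [← F5, mul_smul, ← L, F6, F3, add_mul, mul_add, ← mul_assoc (D.ascSum p _), ← C1.eq]
      simp only [mul_assoc, mul_smul_comm, smul_mul_assoc]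
      rw [← mul_assoc (D.arcSum (p + 1) 1 _), ← C2.eq, mul_assoc]
    rw [F1, F2, mul_add, mul_add, mul_smul_comm, mul_smul_comm, L']
    simp only [mul_add, mul_smul_comm, ← mul_assoc]
    rw [F4', qint_succ q (g + 1)]
    match_scalars <;> ring

end BMWData

end LastArc

section Evaluation

variable {F : Type*} [Field F] {A : Type*} [Ring A] [Algebra F A] {n : ℕ} {q r : F}

namespace BMWData

variable {D : BMWData F A n q r}

theorem cupProd_arcSum_ascSum_ascSum (g m : ℕ) (hg : 2 * g ≤ m) (h : m + 4 = n) :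
    D.cupProd 2 (g + 1) * (D.arcSum m g 4 * (D.ascSum m 4 * D.ascSum (m + 1) 3)) =
      ((1 + q * r⁻¹) * qint q (g + 1)) • (D.cupProd 2 (g + 1) * D.arcSum (m + 2) (g + 1) 2) := by
  have h1 : (1 + q • D.T 3) * D.arcSum (m + 2) 1 2 = D.ascSum m 4 * D.ascSum (m + 1) 3 :=
    D.one_add_mul_arcSum_one m 2 (by omega)
  have h2 := D.firstArc g (m := m) (k := 2) (by omega)
  have c : Commute (1 + q • D.T 3) (D.cupProd 4 g * D.arcSum m g 4) := by
    refine ((Commute.one_left _).add_left (Commute.smul_left ?_ q))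
    exact (commute_cupProd fun j _ _ => D.commute_T_E (by omega) (by omega) (by omega)).mul_right
      (commute_arcSum fun j _ _ => D.commute_T_T (by omega) (by omega) (by omega))
  have e : D.E 3 * (1 + q • D.T 3) = (1 + q * r⁻¹) • D.E 3 := by
    rw [mul_add, mul_smul_comm, D.ET 3 (by omega) (by omega), add_smul, smul_smul, mul_one,
      one_smul]
  have hc : D.cupProd 2 (g + 1) = D.E 3 * D.cupProd 4 g := rfl
  calc _ = D.E 3 * (D.cupProd 4 g * D.arcSum m g 4 * (1 + q • D.T 3)) *
        D.arcSum (m + 2) 1 2 := by rw [← h1, hc]; simp only [mul_assoc]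
    _ = (D.E 3 * (1 + q • D.T 3)) * (D.cupProd 4 g * D.arcSum m g 4) *
        D.arcSum (m + 2) 1 2 := by rw [← c.eq]; simp only [mul_assoc]
    _ = (1 + q * r⁻¹) • (D.cupProd 2 (g + 1) * (D.arcSum m g 4 * D.arcSum (m + 2) 1 2)) := by
      rw [e, hc]; simp only [mul_assoc, smul_mul_assoc]
    _ = _ := by rw [h2, smul_smul]

theorem cupProd_arcSum_ascSum (g p : ℕ) (h : 2 * g + p + 3 = n) :
    D.cupProd 2 g * (D.arcSum (2 * g + p + 1) g 2 * D.ascSum (2 * g + p) 3) =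
      ((1 + q * r⁻¹) * qint q g) • (D.cupProd 2 g * D.arcSum (2 * g + p + 1) g 2) +
        q ^ (2 * g) • (D.cupProd 2 g *
          (D.ascSum p (2 * g + 3) * D.arcSum (2 * g + p + 1) g 2)) := by
  cases g with
  | zero => simp
  | succ g =>
    have h1 : D.cupProd 2 (g + 1) * (D.descProd 2 (2 * g + 2) *
          (D.arcSum (2 * g + p + 2) (g + 1) 3 * D.ascSum (2 * g + p + 2) 3)) =
        D.cupProd 2 (g + 1) *
          (D.ascSum p (2 * g + 5) * D.arcSum (2 * g + p + 3) (g + 1) 2) :=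
      D.freeStrand (g + 1) (by omega) (by omega) (by omega)
    have h2 := D.cupProd_arcSum_ascSum_ascSum g (2 * g + p + 1) (by omega) (by omega)
    have h3 : D.arcSum (2 * g + p + 3) (g + 1) 2 =
        D.arcSum (2 * g + p + 1) g 4 * D.ascSum (2 * g + p + 1) 4 +
          q ^ (2 * g + 2) • (D.descProd 2 (2 * g + 2) *
            D.arcSum (2 * g + p + 2) (g + 1) 3) :=
      arcSum_succ ..
    rw [(by omega : 2 * (g + 1) + p + 1 = 2 * g + p + 3),
      (by omega : 2 * (g + 1) + p = 2 * g + p + 2), (by omega : 2 * (g + 1) + 3 = 2 * g + 5),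
      ← h1, ← h2]
    nth_rw 1 [h3]
    simp only [add_mul, mul_add, smul_mul_assoc, mul_smul_comm, mul_assoc,
      Nat.mul_one, Nat.add_assoc, Nat.reduceAdd]

theorem cupProd_arcSum_ascSum_E (g m : ℕ) (hg : 2 * g ≤ m + 1) (h : m + 3 = n) :
    D.cupProd 0 (g + 1) * (D.arcSum (m + 1) g 2 * (D.ascSum (m + 1) 2 * D.E 1)) =
      (1 + (r - r⁻¹) / (q - q⁻¹)) • (D.cupProd 0 (g + 1) * D.arcSum (m + 1) g 2) +
        (q * r) • (D.E 1 * (D.cupProd 2 g * (D.arcSum (m + 1) g 2 * D.ascSum m 3))) := by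
  have c1 : Commute (D.E 1) (D.cupProd 2 g * D.arcSum (m + 1) g 2) :=
    (commute_cupProd fun j _ _ => D.commute_E_E (by omega) (by omega) (by omega)).mul_right
      (commute_arcSum fun j _ _ => D.commute_E_T (by omega) (by omega) (by omega))
  have c2 : Commute (D.E 1) (D.ascSum m 3) :=
    commute_ascSum fun j _ _ => D.commute_E_T (by omega) (by omega) (by omega)
  have e1 := D.Esq 1 (by omega) (by omega)
  have e2 : D.E 1 * D.T 2 * D.E 1 = r • D.E 1 := D.ETE₁ 1 (by omega) (by omega)
  have hc : D.cupProd 0 (g + 1) = D.E 1 * D.cupProd 2 g := rfl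
  have hs : D.ascSum (m + 1) 2 = 1 + q • (D.T 2 * D.ascSum m 3) := rfl
  calc _ = D.E 1 * (D.cupProd 2 g * D.arcSum (m + 1) g 2) *
        (D.E 1 + q • (D.T 2 * (D.ascSum m 3 * D.E 1))) := by
        rw [hc, hs]; simp only [mul_assoc, add_mul, one_mul, smul_mul_assoc]
    _ = D.cupProd 2 g * D.arcSum (m + 1) g 2 * (D.E 1 * D.E 1) +
        q • (D.cupProd 2 g * D.arcSum (m + 1) g 2 * (D.E 1 * D.T 2 * D.E 1) * D.ascSum m 3) := by
      rw [c1.eq, ← c2.eq]; simp only [mul_assoc, mul_add, mul_smul_comm]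
    _ = _ := by
      rw [e1, e2, mul_smul_comm, mul_smul_comm, smul_mul_assoc, ← c1.eq, smul_smul, hc]
      simp only [mul_assoc]

theorem cupProd_arcSum_E_of_eq (g : ℕ) (h : 2 * g + 2 = n) :
    D.cupProd 0 (g + 1) * (D.arcSum (2 * g + 2) (g + 1) 0 * D.E 1) =
      (1 + (r - r⁻¹) / (q - q⁻¹) + q * r * (1 + q * r⁻¹) * qint q g) •
        (D.cupProd 0 (g + 1) * D.arcSum (2 * g) g 2) := by
  rw [arcSum_succ, arcSum_eq_zero _ _ (by omega : 2 * g + 1 < 2 * (g + 1)), mul_zero, smul_zero,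
    add_zero]
  cases g with
  | zero =>
    simpa [cupProd_succ] using D.Esq 1 (by omega) (by omega)
  | succ g =>
    have h1 := D.cupProd_arcSum_ascSum_E (g + 1) (2 * g + 1) (by omega) (by omega)
    have h2 := D.cupProd_arcSum_ascSum_ascSum g (2 * g) (by omega) (by omega)
    have h3 : D.arcSum (2 * g + 1 + 1) (g + 1) 2 = D.arcSum (2 * g) g 4 * D.ascSum (2 * g) 4 := by
      rw [arcSum_succ, arcSum_eq_zero _ _ (by omega : 2 * g + 1 < 2 * (g + 1)), mul_zero,
        smul_zero, add_zero]
    have hc : D.cupProd 0 (g + 1 + 1) = D.E 1 * D.cupProd 2 (g + 1) := rfl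
    have h4 : D.cupProd 2 (g + 1) * (D.arcSum (2 * g + 1 + 1) (g + 1) 2 * D.ascSum (2 * g + 1) 3) =
        ((1 + q * r⁻¹) * qint q (g + 1)) •
          (D.cupProd 2 (g + 1) * D.arcSum (2 * g + 1 + 1) (g + 1) 2) := by
      rw [← h2, h3, mul_assoc]
    rw [h4] at h1
    rw [(by omega : 2 * (g + 1) = 2 * g + 1 + 1), mul_assoc, h1, hc]
    simp only [mul_smul_comm, mul_assoc]
    match_scalars
    ring

theorem cupProd_arcSum_E_of_lt (g p : ℕ) (h : 2 * g + p + 3 = n) :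
    D.cupProd 0 (g + 1) * (D.arcSum (2 * g + p + 3) (g + 1) 0 * D.E 1) =
      (1 + (r - r⁻¹) / (q - q⁻¹) + q * r * (1 + q * r⁻¹) * qint q g) •
          (D.cupProd 0 (g + 1) * D.arcSum (2 * g + p + 1) g 2) +
        (q * r * q ^ (2 * g) * (1 + q * r⁻¹)) • (D.cupProd 0 (g + 1) *
          (D.ascSum p (2 * g + 3) * D.arcSum (2 * g + p + 1) g 2)) +
        q ^ (4 * g + 4) • (D.cupProd 0 (g + 2) * D.arcSum (2 * g + p + 1) (g + 1) 2) := by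
  have hr := D.hr
  have h1 := D.cupProd_arcSum_ascSum_E g (2 * g + p) (by omega) (by omega)
  have h2 := D.cupProd_arcSum_ascSum g p h
  have h3 : D.arcSum (2 * g + p + 3) (g + 1) 0 =
      D.arcSum (2 * g + p + 1) g 2 * D.ascSum (2 * g + p + 1) 2 + q ^ (2 * g + 2) •
        (D.descProd 0 (2 * g + 2) * D.arcSum (2 * g + p + 2) (g + 1) 1) := arcSum_succ ..
  have h4 : D.arcSum (2 * g + p + 2) (g + 1) 1 =
      D.arcSum (2 * g + p) g 3 * D.ascSum (2 * g + p) 3 + q ^ (2 * g + 2) •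
        (D.descProd 1 (2 * g + 2) * D.arcSum (2 * g + p + 1) (g + 1) 2) := arcSum_succ ..
  have hc : D.cupProd 0 (g + 1) = D.E 1 * D.cupProd 2 g := rfl
  have h5 : D.cupProd 2 g * (D.descProd 2 (2 * g) *
        (D.arcSum (2 * g + p) g 3 * D.ascSum (2 * g + p) 3)) =
      D.cupProd 2 g * (D.ascSum p (2 * g + 3) * D.arcSum (2 * g + p + 1) g 2) :=
    D.freeStrand g (by omega) (by omega) (by omega)
  have h6 : D.cupProd 0 (g + 1) * (D.descProd 0 (2 * g + 2) *
        (D.arcSum (2 * g + p) g 3 * (D.ascSum (2 * g + p) 3 * D.E 1))) =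
      D.E 1 * (D.cupProd 2 g * (D.descProd 2 (2 * g) *
        (D.arcSum (2 * g + p) g 3 * D.ascSum (2 * g + p) 3))) := by
    have c1 : Commute (D.E 1) (D.arcSum (2 * g + p) g 3 * D.ascSum (2 * g + p) 3) :=
      (commute_arcSum fun j _ _ => D.commute_E_T (by omega) (by omega) (by omega)).mul_right
        (commute_ascSum fun j _ _ => D.commute_E_T (by omega) (by omega) (by omega))
    have c2 : Commute (D.E 1) (D.cupProd 2 g * D.descProd 2 (2 * g)) :=
      (commute_cupProd fun j _ _ => D.commute_E_E (by omega) (by omega) (by omega)).mul_right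
        (commute_descProd fun j _ _ => D.commute_E_T (by omega) (by omega) (by omega))
    have e : D.descProd 0 (2 * g + 2) = D.descProd 2 (2 * g) * (D.T 2 * D.T 1) :=
      descProd_add_two ..
    have e2 : D.E 1 * (D.T 2 * D.T 1) * D.E 1 = D.E 1 := by
      rw [mul_assoc, mul_assoc, D.TE 1 (by omega) (by omega), mul_smul_comm, mul_smul_comm,
        ← mul_assoc, D.ETE₁ 1 (by omega) (by omega), smul_smul, inv_mul_cancel₀ hr, one_smul]
    calc _ = D.E 1 * (D.cupProd 2 g * D.descProd 2 (2 * g)) * ((D.T 2 * D.T 1) *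
          (D.arcSum (2 * g + p) g 3 * D.ascSum (2 * g + p) 3 * D.E 1)) := by
          rw [hc, e]; simp only [mul_assoc]
      _ = D.cupProd 2 g * D.descProd 2 (2 * g) * (D.E 1 * (D.T 2 * D.T 1) * D.E 1) *
          (D.arcSum (2 * g + p) g 3 * D.ascSum (2 * g + p) 3) := by
          rw [← c1.eq, c2.eq]; simp only [mul_assoc]
      _ = _ := by rw [e2, ← c2.eq]; simp only [mul_assoc]
  have h7 : D.cupProd 0 (g + 1) * (D.descProd 0 (2 * g + 2) * (D.descProd 1 (2 * g + 2) *
        (D.arcSum (2 * g + p + 1) (g + 1) 2 * D.E 1))) =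
      D.cupProd 0 (g + 2) * D.arcSum (2 * g + p + 1) (g + 1) 2 := by
    rcases Nat.eq_zero_or_pos p with rfl | hp
    · rw [arcSum_eq_zero _ _ (by omega : 2 * g + 0 + 1 < 2 * (g + 1))]
      simp
    have c1 : Commute (D.E 1) (D.arcSum (2 * g + p + 1) (g + 1) 2) :=
      commute_arcSum fun j _ _ => D.commute_E_T (by omega) (by omega) (by omega)
    have e1 : D.descProd 0 (2 * g + 2) * D.descProd 1 (2 * g + 2) * D.E 1 =
        D.E (2 * g + 3) * (D.descProd 0 (2 * g + 2) * D.descProd 1 (2 * g + 2)) := by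
      have := D.descProd_mul_descProd_mul_E 0 (2 * g + 2) (by omega)
      rwa [(by omega : 0 + (2 * g + 2) + 1 = 2 * g + 3)] at this
    have e2 : D.cupProd 0 (g + 2) * (D.descProd 0 (2 * g + 2) * D.descProd 1 (2 * g + 2)) =
        D.cupProd 0 (g + 2) :=
      D.cupProd_mul_descProd_mul_descProd 0 (g + 1) (by omega)
    have e3 : D.cupProd 0 (g + 2) = D.cupProd 0 (g + 1) * D.E (2 * g + 3) := by
      rw [cupProd_succ', (by omega : 0 + 2 * (g + 1) + 1 = 2 * g + 3)]
    calc _ = D.cupProd 0 (g + 1) * (D.descProd 0 (2 * g + 2) * D.descProd 1 (2 * g + 2) * D.E 1) *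
          D.arcSum (2 * g + p + 1) (g + 1) 2 := by rw [← c1.eq]; simp only [mul_assoc]
      _ = _ := by rw [e1, ← mul_assoc, ← e3, e2]
  rw [h3, h4]
  simp only [add_mul, mul_add, smul_mul_assoc, mul_smul_comm, mul_assoc, smul_add]
  rw [h1, h6, h5, h7, h2, hc]
  simp only [mul_add, mul_smul_comm, mul_assoc]
  match_scalars
  · ring
  · field_simp
    ring
  · ring

/-- The part of the behaviour of `Ŝ_n` under right multiplication that is needed below. -/
structure Absorbs (D : BMWData F A n q r) (S : A) : Prop where
  mul_T : ∀ {i}, 1 ≤ i → i < n → (1 + q * r⁻¹) • (S * D.T i) =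
    (q * (1 + q * r⁻¹)) • S - ((q ^ 2 - 1) * r⁻¹) • (S * D.E i)
  mul_E_mul_E : ∀ {i}, 1 ≤ i → i + 1 < n → S * D.E i * D.E (i + 1) = S * D.E (i + 1)

theorem Absorbs.mul_ascSum {S : A} (hS : D.Absorbs S) (m k : ℕ) (h : k + m + 1 = n) :
    (1 + q * r⁻¹) • (S * D.ascSum m (k + 1)) = ((1 + q * r⁻¹) * qint q (m + 1)) • S -
      ((q ^ 2 - 1) * r⁻¹ * q) • (S * (D.E (k + 1) * D.arcSum (m + 1) 1 k)) := by
  induction m generalizing k with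
  | zero =>
    rw [arcSum_eq_zero _ _ (by omega)]
    simp
  | succ m ih =>
    have ih' := congrArg (q ^ 2 • ·) (ih (k + 1) (by omega))
    have hT := congrArg (fun x => q • (x * D.ascSum m (k + 2)))
      (hS.mul_T (i := k + 1) (by omega) (by omega))
    have hE : S * (D.E (k + 1) * (D.T (k + 2) * (D.T (k + 1) *
        D.arcSum (m + 1) 1 (k + 1)))) = S * (D.E (k + 2) * D.arcSum (m + 1) 1 (k + 1)) := by
      rcases Nat.eq_zero_or_pos m with rfl | hm
      · rw [arcSum_eq_zero _ _ (by omega : 0 + 1 < 2 * 1)]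
        simp
      have e : D.E (k + 1) * (D.T (k + 2) * D.T (k + 1)) = D.E (k + 1) * D.E (k + 2) :=
        D.E_T_T' (by omega) (by omega)
      have e' : S * D.E (k + 1) * D.E (k + 2) = S * D.E (k + 2) :=
        hS.mul_E_mul_E (by omega) (by omega)
      rw [← mul_assoc (D.T _), ← mul_assoc (D.E _), e, ← mul_assoc, ← mul_assoc, e', mul_assoc]
    rw [ascSum_succ, arcSum_one_succ, qint_succ']
    simp only [sub_mul, mul_add, mul_one, smul_mul_assoc, mul_smul_comm, mul_assoc,
      Nat.add_assoc, Nat.reduceAdd] at ih' hT hE ⊢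
    rw [hE]
    rw [← sub_eq_zero] at hT ih' ⊢
    rw [← add_zero (0 : A)]
    nth_rw 1 [← hT]
    rw [← ih']
    module

end BMWData

end Evaluation

section Absorption

variable {F : Type*} [Field F] {A : Type*} [Ring A] [Algebra F A] {n : ℕ} {q r : F}

namespace BMWData

variable {D : BMWData F A n q r}

theorem loop_add_qint (D : BMWData F A n q r) (g : ℕ) :
    1 + (r - r⁻¹) / (q - q⁻¹) + q * r * (1 + q * r⁻¹) * qint q g =
      (r * q ^ (2 * g) - q⁻¹) * (1 + q * r⁻¹) / (q - q⁻¹) := by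
  have hz := D.hqq
  have hq := D.hq
  have hr := D.hr
  have hg := qint_mul q g
  have h2 : q * (q - q⁻¹) = q ^ 2 - 1 := by field_simp
  rw [eq_div_iff hz, add_mul, add_mul, div_mul_cancel₀ _ hz]
  have h3 : q * r * (1 + q * r⁻¹) * qint q g * (q - q⁻¹) =
      r * (1 + q * r⁻¹) * (q ^ (2 * g) - 1) := by
    rw [← hg, ← h2]; ring
  rw [h3]
  field_simp
  ring

theorem Absorbs.mul_cupProd_arcSum_E {S : A} (hS : D.Absorbs S) (g p : ℕ)
    (h : 2 * g + p + 2 = n) :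
    S * (D.cupProd 0 (g + 1) * (D.arcSum (2 * g + p + 2) (g + 1) 0 * D.E 1)) =
      ((r * q ^ (2 * (g + p)) - q⁻¹) * (1 + q * r⁻¹) / (q - q⁻¹)) •
          (S * (D.cupProd 0 (g + 1) * D.arcSum (2 * g + p) g 2)) +
        q ^ (2 * g + 2) • (S * (D.cupProd 0 (g + 2) * D.arcSum (2 * g + p) (g + 1) 2)) := by
  rw [← D.loop_add_qint]
  cases p with
  | zero =>
    rw [add_zero, D.cupProd_arcSum_E_of_eq g h,
      arcSum_eq_zero _ _ (by omega : 2 * g < 2 * (g + 1))]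
    simp
  | succ p =>
    have c1 : Commute (D.ascSum p (2 * g + 3)) (D.cupProd 0 (g + 1)) :=
      commute_cupProd fun i _ _ => (commute_ascSum fun j _ _ =>
        D.commute_E_T (by omega) (by omega) (by omega)).symm
    have e' : (1 + q * r⁻¹) • (S * (D.cupProd 0 (g + 1) * (D.ascSum p (2 * g + 3) *
        D.arcSum (2 * g + p + 1) g 2))) =
        ((1 + q * r⁻¹) * qint q (p + 1)) •
          (S * (D.cupProd 0 (g + 1) * D.arcSum (2 * g + p + 1) g 2)) -
        ((q ^ 2 - 1) * r⁻¹ * q * qint q (g + 1)) •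
          (S * (D.cupProd 0 (g + 2) * D.arcSum (2 * g + p + 1) (g + 1) 2)) := by
      rcases Nat.eq_zero_or_pos p with rfl | hp
      · rw [arcSum_eq_zero _ _ (by omega : 2 * g + 0 + 1 < 2 * (g + 1))]
        simp
      have c2 : Commute (D.arcSum (p + 1) 1 (2 * g + 2)) (D.cupProd 0 (g + 1)) :=
        commute_cupProd fun i _ _ => (commute_arcSum fun j _ _ =>
          D.commute_E_T (by omega) (by omega) (by omega)).symm
      have c3 : Commute (D.E (2 * g + 3)) (D.cupProd 0 (g + 1)) :=
        commute_cupProd fun i _ _ => (D.commute_E_E (by omega) (by omega) (by omega)).symm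
      have e3 : D.cupProd 0 (g + 2) = D.E (2 * g + 3) * D.cupProd 0 (g + 1) := by
        rw [c3.eq, D.cupProd_succ' 0 (g + 1), (by omega : 0 + 2 * (g + 1) + 1 = 2 * g + 3)]
      have e4 : D.cupProd 0 (g + 2) * (D.arcSum (p + 1) 1 (2 * g + 2) *
          D.arcSum (2 * g + p + 1) g 2) =
          qint q (g + 1) • (D.cupProd 0 (g + 2) * D.arcSum (2 * g + p + 1) (g + 1) 2) := by
        have := D.lastArc (g := g) (p := p + 1) (k := 2) (by omega)
        rw [add_comm 2 (2 * g)] at this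
        rw [cupProd_succ, mul_assoc, mul_assoc, ← mul_smul_comm]
        exact congrArg (D.E 1 * ·) this
      have e := congrArg (· * (D.cupProd 0 (g + 1) * D.arcSum (2 * g + p + 1) g 2))
        (hS.mul_ascSum p (2 * g + 2) (by omega))
      simp only [sub_mul, smul_mul_assoc, mul_assoc] at e
      rw [← mul_assoc (D.ascSum _ _), c1.eq, ← mul_assoc (D.arcSum (p + 1) _ _), c2.eq,
        mul_assoc, mul_assoc, ← mul_assoc (D.E _), ← e3, e4] at e
      rw [e, mul_smul_comm, smul_smul]
      congr 2
      ring
    rw [(by omega : 2 * g + (p + 1) + 2 = 2 * g + p + 3), ← Nat.add_assoc (2 * g),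
      D.cupProd_arcSum_E_of_lt g p (by omega)]
    rw [mul_add, mul_add, mul_smul_comm, mul_smul_comm, mul_smul_comm, mul_smul (q * r * q ^ (2 * g)), e']
    have hr := D.hr
    have h1 := qint_mul q (g + 1)
    have h2 : qint q (g + (p + 1)) = qint q g + q ^ (2 * g) * qint q (p + 1) := by
      simp only [qint, sum_range_add, mul_sum, mul_add, pow_add]
    rw [h2]
    match_scalars
    · ring
    · have : q * r * q ^ (2 * g) * ((q ^ 2 - 1) * r⁻¹ * q * qint q (g + 1)) =
          q ^ (2 * g + 2) * (q ^ (2 * (g + 1)) - 1) := by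
        rw [← h1]
        field_simp
        ring
      linear_combination -this

end BMWData

end Absorption

section Permutations

variable {n : ℕ}

/-- The action of a permutation of `{0, …, n-1}` on `ℕ`, fixing all `x ≥ n`. -/
def ev (w : Equiv.Perm (Fin n)) (x : ℕ) : ℕ := if h : x < n then w ⟨x, h⟩ else x

theorem ev_of_lt (w : Equiv.Perm (Fin n)) {x : ℕ} (h : x < n) : ev w x = w ⟨x, h⟩ := dif_pos h

@[simp] theorem ev_val (w : Equiv.Perm (Fin n)) (x : Fin n) : ev w x = w x := ev_of_lt w x.2

theorem ev_of_le (w : Equiv.Perm (Fin n)) {x : ℕ} (h : n ≤ x) : ev w x = x :=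
  dif_neg (by omega)

theorem ev_lt_iff (w : Equiv.Perm (Fin n)) {x : ℕ} : ev w x < n ↔ x < n := by
  by_cases h : x < n
  · simp [ev_of_lt w h, h]
  · rw [ev_of_le w (by omega)]

@[simp] theorem ev_one (x : ℕ) : ev (1 : Equiv.Perm (Fin n)) x = x := by simp [ev]

@[simp] theorem ev_mul (u v : Equiv.Perm (Fin n)) (x : ℕ) : ev (u * v) x = ev u (ev v x) := by
  by_cases h : x < n
  · rw [ev_of_lt _ h, ev_of_lt v h, ev_val, Equiv.Perm.mul_apply]
  · rw [ev_of_le _ (by omega), ev_of_le v (by omega), ev_of_le u (by omega)]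

@[simp] theorem ev_inv_ev (w : Equiv.Perm (Fin n)) (x : ℕ) : ev w⁻¹ (ev w x) = x := by
  rw [← ev_mul, inv_mul_cancel, ev_one]

@[simp] theorem ev_ev_inv (w : Equiv.Perm (Fin n)) (x : ℕ) : ev w (ev w⁻¹ x) = x := by
  rw [← ev_mul, mul_inv_cancel, ev_one]

@[simp] theorem ev_inj (w : Equiv.Perm (Fin n)) {x y : ℕ} : ev w x = ev w y ↔ x = y :=
  ⟨fun h => by rw [← ev_inv_ev w x, h, ev_inv_ev], fun h => h ▸ rfl⟩

theorem ev_ext {u v : Equiv.Perm (Fin n)} (h : ∀ x < n, ev u x = ev v x) : u = v := by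
  ext x
  simpa using h x x.2

theorem ev_sGen {i : ℕ} (h : i + 1 < n) (x : ℕ) :
    ev (sGen n (i + 1)) x = if x = i then i + 1 else if x = i + 1 then i else x := by
  by_cases hx : x < n
  · rw [ev_of_lt _ hx, sGen, dif_pos ⟨by omega, h⟩, Equiv.swap_apply_def]
    simp only [Fin.ext_iff, Nat.add_sub_cancel]
    split_ifs <;> simp
  · rw [ev_of_le _ (by omega), if_neg (by omega), if_neg (by omega)]

theorem sGen_mul_sGen {i : ℕ} (h : i + 1 < n) : sGen n (i + 1) * sGen n (i + 1) = 1 := by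
  rw [sGen, dif_pos ⟨by omega, h⟩, Equiv.swap_mul_self]

theorem sGen_inv {i : ℕ} (h : i + 1 < n) : (sGen n (i + 1))⁻¹ = sGen n (i + 1) :=
  inv_eq_of_mul_eq_one_right (sGen_mul_sGen h)

@[simp] theorem len_one : len (1 : Equiv.Perm (Fin n)) = 0 := by
  rw [len, card_eq_zero, filter_eq_empty_iff]
  rintro p - ⟨h1, h2⟩
  exact absurd h2 (not_lt.2 h1.le)

theorem len_inv (w : Equiv.Perm (Fin n)) : len w⁻¹ = len w := by
  refine card_nbij' (fun p => (w⁻¹ p.2, w⁻¹ p.1)) (fun p => (w p.2, w p.1)) ?_ ?_ ?_ ?_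
  · intro p; simp +contextual
  · intro p; simp +contextual
  · intro p; simp
  · intro p; simp

theorem len_mul_sGen (w : Equiv.Perm (Fin n)) {i : ℕ} (h : i + 1 < n)
    (hw : ev w i < ev w (i + 1)) : len (w * sGen n (i + 1)) = len w + 1 := by
  have hs := fun x : Fin n => ev_sGen h x
  set s := sGen n (i + 1) with hsdef
  have hss : ∀ x, s (s x) = x := fun x => by
    rw [← Equiv.Perm.mul_apply, sGen_mul_sGen h, Equiv.Perm.one_apply]
  let a : Fin n := ⟨i, by omega⟩
  let b : Fin n := ⟨i + 1, h⟩
  have hab : w a < w b := by rwa [ev_of_lt w (by omega), ev_of_lt w h] at hw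
  have ha : s a = b := by
    apply Fin.ext
    rw [← ev_val, hs]
    simp [a, b]
  have hb : s b = a := by rw [← ha, hss]
  have hlt : ∀ x y : Fin n, x < y → (x, y) ≠ (a, b) → s x < s y := by
    intro x y hxy hne
    rw [Fin.lt_def, ← ev_val, ← ev_val, hs, hs]
    simp only [a, b, ne_eq, Prod.mk.injEq, Fin.ext_iff] at hne
    split_ifs <;> omega
  have key : univ.filter (fun p : Fin n × Fin n => p.1 < p.2 ∧ (w * s) p.2 < (w * s) p.1) =
      insert (a, b) ((univ.filter (fun p : Fin n × Fin n => p.1 < p.2 ∧ w p.2 < w p.1)).image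
        fun p => (s p.1, s p.2)) := by
    ext ⟨x, y⟩
    rw [mem_filter, Equiv.Perm.mul_apply, Equiv.Perm.mul_apply]
    simp only [mem_filter, mem_univ, true_and, mem_insert, mem_image, Prod.exists,
      Prod.mk.injEq]
    constructor
    · rintro ⟨h1, h2⟩
      by_cases hne : (x, y) = (a, b)
      · exact Or.inl (by simpa using hne)
      · exact Or.inr ⟨s x, s y, ⟨hlt x y h1 hne, h2⟩, hss x, hss y⟩
    · rintro (⟨rfl, rfl⟩ | ⟨u, v, ⟨h1, h2⟩, rfl, rfl⟩)
      · rw [ha, hb]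
        exact ⟨by simp [a, b, Fin.lt_def], hab⟩
      · refine ⟨hlt u v h1 ?_, by rwa [hss, hss]⟩
        rintro h3
        obtain ⟨rfl, rfl⟩ := Prod.mk.inj h3
        exact absurd hab (not_lt.2 h2.le)
  rw [len, key, card_insert_of_notMem, card_image_of_injective, len]
  · intro p p' hp
    simpa [Prod.ext_iff] using hp
  · simp only [mem_image, mem_filter, mem_univ, true_and, Prod.exists, Prod.mk.injEq, not_exists,
      not_and]
    rintro u v ⟨h1, -⟩ hu hv
    have : u = b := by rw [← hss u, hu, ha]
    have : v = a := by rw [← hss v, hv, hb]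
    subst u v
    simp [a, b, Fin.lt_def] at h1

theorem len_sGen {i : ℕ} (h : i + 1 < n) : len (sGen n (i + 1)) = 1 := by
  simpa using len_mul_sGen 1 h (by simp)

end Permutations

section SymmetricSum

variable {F : Type*} [Field F] {A : Type*} [Ring A] [Algebra F A] {n : ℕ} {q r : F}

namespace BMWData

variable (D : BMWData F A n q r)

theorem Tw_mul_sGen (w : Equiv.Perm (Fin n)) {i : ℕ} (h : i + 1 < n)
    (hw : ev w i < ev w (i + 1)) : D.Tw (w * sGen n (i + 1)) = D.Tw w * D.T (i + 1) := by
  rw [D.Tw_mul _ _ (by rw [len_mul_sGen w h hw, len_sGen h]), D.Tw_s _ (by omega) (by omega)]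

open scoped Classical in
/-- The hat of the set of all permutations satisfying `P`. -/
noncomputable def hatOn (P : Equiv.Perm (Fin n) → Prop) : A := hat q D.Tw (univ.filter P)

theorem hatOn_mul_T {i : ℕ} (h : i + 1 < n) {P Q : Equiv.Perm (Fin n) → Prop}
    (hP : ∀ w, P w → ev w i < ev w (i + 1)) (hQ : ∀ w, Q w ↔ P (w * sGen n (i + 1))) :
    D.hatOn Q = D.hatOn P * q • D.T (i + 1) := by
  rw [hatOn, hatOn, hat, hat, sum_mul]
  refine sum_nbij' (· * sGen n (i + 1)) (· * sGen n (i + 1)) ?_ ?_ ?_ ?_ ?_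
  · intro w; simp [hQ]
  · intro w; simp [hQ, mul_assoc, sGen_mul_sGen h]
  · intro w; simp [mul_assoc, sGen_mul_sGen h]
  · intro w; simp [mul_assoc, sGen_mul_sGen h]
  · intro w hw
    have hw' : P (w * sGen n (i + 1)) := by simpa [hQ] using hw
    obtain ⟨v, rfl⟩ : ∃ v, w = v * sGen n (i + 1) :=
      ⟨w * sGen n (i + 1), by rw [mul_assoc, sGen_mul_sGen h, mul_one]⟩
    rw [mul_assoc, sGen_mul_sGen h, mul_one] at hw' ⊢
    rw [len_mul_sGen v h (hP v hw'), D.Tw_mul_sGen v h (hP v hw'), smul_mul_smul_comm, pow_succ]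

theorem exists_hat_univ_eq {i : ℕ} (h : i + 1 < n) :
    ∃ X, hat q D.Tw univ = X * (1 + q • D.T (i + 1)) := by
  refine ⟨D.hatOn fun w => ev w i < ev w (i + 1), ?_⟩
  rw [mul_add, mul_one, ← D.hatOn_mul_T (Q := fun w => ev w (i + 1) < ev w i) h
    (fun _ hw => hw) (fun w => by simp [ev_sGen h])]
  simp only [hatOn, hat, sum_filter, ← sum_add_distrib]
  refine sum_congr rfl fun w _ => ?_
  have : ev w i ≠ ev w (i + 1) := by simp
  rcases lt_or_gt_of_ne this with h1 | h1 <;> simp [h1, not_lt.2 h1.le]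

/-- The hat of the set of all `w` with `w x < w y < w z`. -/
noncomputable def hatOrder (x y z : ℕ) : A :=
  D.hatOn fun w => ev w x < ev w y ∧ ev w y < ev w z

theorem hat_univ_eq_sum_hatOrder {x y z : ℕ} (h1 : x ≠ y) (h2 : x ≠ z) (h3 : y ≠ z) :
    hat q D.Tw univ = D.hatOrder x y z + D.hatOrder y x z + D.hatOrder x z y +
      D.hatOrder z x y + D.hatOrder y z x + D.hatOrder z y x := by
  simp only [hatOrder, hatOn, hat, sum_filter, ← sum_add_distrib]
  refine sum_congr rfl fun w _ => ?_
  have n1 : ev w x ≠ ev w y := by simpa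
  have n2 : ev w x ≠ ev w z := by simpa
  have n3 : ev w y ≠ ev w z := by simpa
  rcases lt_or_gt_of_ne n1 with l1 | l1 <;> rcases lt_or_gt_of_ne n2 with l2 | l2 <;>
    rcases lt_or_gt_of_ne n3 with l3 | l3 <;>
    first
    | omega
    | simp [l1, l2, l3, not_lt.2 l1.le, not_lt.2 l2.le, not_lt.2 l3.le]

theorem exists_hat_univ_eq_braid {i : ℕ} (h : i + 2 < n) :
    ∃ Y, hat q D.Tw univ = Y * (1 + q • D.T (i + 1) + q • D.T (i + 2) +
      q ^ 2 • (D.T (i + 1) * D.T (i + 2)) + q ^ 2 • (D.T (i + 2) * D.T (i + 1)) +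
      q ^ 3 • (D.T (i + 1) * D.T (i + 2) * D.T (i + 1))) := by
  have h' : i + 1 < n := by omega
  have hi : i ≠ i + 1 + 1 := by omega
  have e1 : D.hatOrder (i + 1) i (i + 2) = D.hatOrder i (i + 1) (i + 2) * q • D.T (i + 1) :=
    D.hatOn_mul_T h' (fun _ hw => hw.1) fun w => by simp [ev_sGen h']
  have e2 : D.hatOrder i (i + 2) (i + 1) = D.hatOrder i (i + 1) (i + 2) * q • D.T (i + 2) :=
    D.hatOn_mul_T h (fun _ hw => hw.2) fun w => by simp [ev_sGen h, hi]
  have e3 : D.hatOrder (i + 2) i (i + 1) = D.hatOrder (i + 1) i (i + 2) * q • D.T (i + 2) :=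
    D.hatOn_mul_T h (fun _ hw => hw.1.trans hw.2) fun w => by simp [ev_sGen h, hi]
  have e4 : D.hatOrder (i + 1) (i + 2) i = D.hatOrder i (i + 2) (i + 1) * q • D.T (i + 1) :=
    D.hatOn_mul_T h' (fun _ hw => hw.1.trans hw.2) fun w => by simp [ev_sGen h']
  have e5 : D.hatOrder (i + 2) (i + 1) i = D.hatOrder (i + 2) i (i + 1) * q • D.T (i + 1) :=
    D.hatOn_mul_T h' (fun _ hw => hw.2) fun w => by simp [ev_sGen h']
  refine ⟨D.hatOrder i (i + 1) (i + 2), ?_⟩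
  rw [D.hat_univ_eq_sum_hatOrder (by omega : i ≠ i + 1) (by omega : i ≠ i + 2) (by omega),
    e5, e4, e3, e2, e1]
  simp only [mul_add, mul_one, mul_smul_comm, smul_mul_assoc, smul_smul, mul_assoc]
  module

theorem absorbs_hat_univ : D.Absorbs (hat q D.Tw univ) where
  mul_T {i} h1 h2 := by
    obtain ⟨j, rfl⟩ : ∃ j, i = j + 1 := ⟨i - 1, by omega⟩
    obtain ⟨X, hX⟩ := D.exists_hat_univ_eq h2
    have hq := D.hq
    have hT := D.T_sq h1 h2
    have hE := D.TE (j + 1) h1 (by omega)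
    rw [hX]
    simp only [mul_add, add_mul, mul_one, mul_smul_comm, smul_mul_assoc, mul_assoc, hT, hE,
      mul_sub]
    match_scalars <;> field_simp <;> ring
  mul_E_mul_E {i} h1 h2 := by
    obtain ⟨j, rfl⟩ : ∃ j, i = j + 1 := ⟨i - 1, by omega⟩
    obtain ⟨Y, hY⟩ := D.exists_hat_univ_eq_braid h2
    have hq := D.hq
    have hr := D.hr
    have t1 := D.T_sq (i := j + 2) (by omega) h2
    have f1 := D.TE (j + 1) h1 (by omega)
    have f2 := D.TE (j + 2) (by omega) (by omega)
    have g1 := D.TTE₁ (j + 1) h1 (by omega)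
    have g2 := D.TTE₂ (j + 1) h1 (by omega)
    have c2 := D.ETE₂ (j + 1) h1 (by omega)
    have c3 := D.EEE₂ (j + 1) h1 (by omega)
    simp only [mul_assoc, Nat.add_assoc, Nat.reduceAdd] at *
    have k1 : D.T (j + 2) * (D.E (j + 1) * D.E (j + 2)) = D.T (j + 1) * D.E (j + 2) +
        (q - q⁻¹) • (D.E (j + 1) * D.E (j + 2)) - (q - q⁻¹) • D.E (j + 2) := by
      rw [← g2, ← mul_assoc, t1]
      simp only [add_mul, sub_mul, one_mul, smul_mul_assoc, mul_assoc, g2, c2, smul_sub, smul_smul]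
      match_scalars <;> field_simp
    have k2 : D.T (j + 1) * (D.T (j + 2) * (D.E (j + 1) * D.E (j + 2))) = D.E (j + 2) := by
      rw [← mul_assoc (D.T (j + 2)), ← mul_assoc, g1, mul_assoc, c3]
    have k3 : D.T (j + 1) * (D.E (j + 1) * D.E (j + 2)) = r⁻¹ • (D.E (j + 1) * D.E (j + 2)) := by
      rw [← mul_assoc, f1, smul_mul_assoc]
    rw [hY]
    simp only [mul_assoc]
    congr 1
    simp only [add_mul, one_mul, smul_mul_assoc, mul_assoc, f2, k3, k2, g2, mul_smul_comm]
    rw [k1]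
    match_scalars <;> field_simp <;> ring

end BMWData

end SymmetricSum

section Cycles

variable {n : ℕ}

/-- `cyc k j = s_{k+1} s_{k+2} ⋯ s_{k+j}`, the permutation moving the (0-based) point `k+j`
to `k` and raising each of `k, …, k+j-1` by one. -/
def cyc (n : ℕ) : ℕ → ℕ → Equiv.Perm (Fin n)
  | _, 0 => 1
  | k, j + 1 => sGen n (k + 1) * cyc n (k + 1) j

theorem ev_cyc {k j : ℕ} (h : k + j < n) (x : ℕ) : ev (cyc n k j) x =
    if x = k + j then k else if k ≤ x ∧ x < k + j then x + 1 else x := by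
  induction j generalizing k with
  | zero =>
    rw [cyc, ev_one]
    split_ifs <;> omega
  | succ j ih =>
    rw [cyc, ev_mul, ih (by omega), ev_sGen (by omega)]
    split_ifs <;> omega

theorem ev_cyc_inv {k j : ℕ} (h : k + j < n) (x : ℕ) : ev (cyc n k j)⁻¹ x =
    if x = k then k + j else if k < x ∧ x ≤ k + j then x - 1 else x := by
  rw [← ev_inj (cyc n k j), ev_ev_inv, ev_cyc h]
  split_ifs <;> omega

theorem len_mul_cyc (w : Equiv.Perm (Fin n)) {k j : ℕ} (h : k + j < n)
    (hw : ∀ y, k < y → y ≤ k + j → ev w k < ev w y) : len (w * cyc n k j) = len w + j := by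
  induction j generalizing k w with
  | zero => simp [cyc]
  | succ j ih =>
    have hs := fun x => ev_sGen (n := n) (by omega : k + 1 < n) x
    rw [cyc, ← mul_assoc, ih _ (by omega), len_mul_sGen w (by omega) (hw _ (by omega) (by omega))]
    · omega
    · intro y h1 h2
      rw [ev_mul, ev_mul, hs, hs, if_neg (by omega), if_pos rfl, if_neg (by omega),
        if_neg (by omega)]
      exact hw y (by omega) (by omega)

theorem len_cyc {k j : ℕ} (h : k + j < n) : len (cyc n k j) = j := by
  simpa using len_mul_cyc 1 h (by simp +contextual)

end Cycles

section CycleSums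

variable {F : Type*} [Field F] {A : Type*} [Ring A] [Algebra F A] {n : ℕ} {q r : F}

namespace BMWData

variable (D : BMWData F A n q r)

theorem ascSum_eq_sum {k m : ℕ} (h : k + m < n) :
    D.ascSum m (k + 1) = ∑ j ∈ range (m + 1), q ^ j • D.Tw (cyc n k j) := by
  induction m generalizing k with
  | zero => simp [cyc, D.Tw_one]
  | succ m ih =>
    rw [ascSum_succ, ih (by omega), sum_range_succ' _ (m + 1), mul_sum, smul_sum, add_comm]
    congr 1
    · refine sum_congr rfl fun j hj => ?_
      rw [mem_range] at hj
      rw [cyc, D.Tw_mul _ _ (by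
        rw [len_sGen (by omega), len_cyc (by omega), ← cyc, len_cyc (by omega), add_comm]),
        D.Tw_s _ (by omega) (by omega), mul_smul_comm, smul_smul, pow_succ']
    · simp [cyc, D.Tw_one]

theorem descProd_eq {k l : ℕ} (h : k + l < n) : D.descProd k l = D.Tw (cyc n k l)⁻¹ := by
  induction l generalizing k with
  | zero => simp [cyc, D.Tw_one]
  | succ l ih =>
    rw [descProd_succ', ih (by omega), cyc, mul_inv_rev, D.Tw_mul _ _ (by
      rw [← mul_inv_rev, ← cyc, len_inv, len_inv, len_inv, len_cyc h, len_cyc (by omega),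
        len_sGen (by omega)]), sGen_inv (by omega), D.Tw_s _ (by omega) (by omega)]

end BMWData

end CycleSums

section ArcSets

variable {n : ℕ}

/-- The condition on the word `e = d⁻¹` that `d` permutes the (0-based) points `k, …, n-1` only,
that the first `f` consecutive pairs of them form arcs, listed by increasing left end points, and
that the remaining points are free, in increasing order. -/
structure IsArcWord (n k f : ℕ) (e : ℕ → ℕ) : Prop where
  fix : ∀ i < k, e i = i
  left : ∀ i, i + 1 < f → e (k + 2 * i) < e (k + 2 * i + 2)
  arc : ∀ i < f, e (k + 2 * i) < e (k + 2 * i + 1)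
  free : ∀ i, k + 2 * f ≤ i → i + 1 < n → e i < e (i + 1)

open scoped Classical in
/-- The set of permutations satisfying `IsArcWord`. -/
noncomputable def arcSet (n k f : ℕ) : Finset (Equiv.Perm (Fin n)) :=
  univ.filter fun d => IsArcWord n k f (ev d⁻¹)

theorem mem_arcSet {k f : ℕ} {d : Equiv.Perm (Fin n)} :
    d ∈ arcSet n k f ↔ IsArcWord n k f (ev d⁻¹) := by simp [arcSet]

theorem le_ev_of_fix {k : ℕ} {d : Equiv.Perm (Fin n)} (h : ∀ i < k, ev d i = i) {x : ℕ}
    (hx : k ≤ x) : k ≤ ev d x := by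
  by_contra hlt
  have := h _ (not_le.1 hlt)
  rw [ev_inj] at this
  omega

theorem eq_one_of_strictMono {d : Equiv.Perm (Fin n)} (h : StrictMono d) : d = 1 := by
  have : h.orderIsoOfSurjective d d.surjective = OrderIso.refl _ := Subsingleton.elim _ _
  ext x
  exact congrArg Fin.val (DFunLike.congr_fun this x)

theorem arcSet_zero (k : ℕ) : arcSet n k 0 = {1} := by
  ext d
  rw [mem_arcSet, mem_singleton]
  constructor
  · intro h
    rw [← inv_eq_one]
    refine eq_one_of_strictMono ?_
    have hs : ∀ i, i + 1 < n → ev d⁻¹ i < ev d⁻¹ (i + 1) := by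
      intro i hi
      rcases lt_or_ge i k with hik | hik
      · have := h.fix i hik
        rcases (by omega : i + 1 < k ∨ k ≤ i + 1) with h' | h'
        · have := h.fix _ h'
          omega
        · have := le_ev_of_fix h.fix h'
          omega
      · exact h.free i (by omega) hi
    intro a b hab
    have : ∀ j, (a : ℕ) + j + 1 < n → ev d⁻¹ a < ev d⁻¹ (a + j + 1) := by
      intro j
      induction j with
      | zero => exact hs _
      | succ j ih => exact fun hj => (ih (by omega)).trans (hs _ hj)
    have := this (b - a - 1) (by omega)
    rw [(by omega : (a : ℕ) + (b - a - 1) + 1 = b)] at this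
    simpa using this
  · rintro rfl
    constructor <;> simp

theorem Hset_eq_arcSet {f : ℕ} (h : 2 * f ≤ n) : Hset n f = arcSet n 0 f := by
  have hp : ∀ (d : Equiv.Perm (Fin n)) i, i < n → pimg d (i + 1) = ev d⁻¹ i + 1 := by
    intro d i hi
    rw [pimg, dif_pos (by omega), ev_of_lt _ hi]
    rfl
  ext d
  rw [mem_arcSet]
  simp only [Hset, mem_filter_univ, mem_Icc]
  constructor
  · rintro ⟨h1, h2, h3⟩
    refine ⟨by simp, fun i hi => ?_, fun i hi => ?_, fun i hi hi' => ?_⟩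
    · have := h1 (i + 1) (by omega)
      rw [(by omega : 2 * (i + 1) - 1 = 2 * i + 1), (by omega : 2 * (i + 1) + 1 = 2 * i + 2 + 1),
        hp _ _ (by omega), hp _ _ (by omega)] at this
      simpa using this
    · have := h2 (i + 1) (by omega)
      rw [(by omega : 2 * (i + 1) - 1 = 2 * i + 1), (by omega : 2 * (i + 1) = 2 * i + 1 + 1),
        hp _ _ (by omega), hp _ _ (by omega)] at this
      simpa using this
    · have := h3 (i + 1) (by omega)
      rw [hp _ _ (by omega), hp _ _ (by omega)] at this
      simpa using this
  · intro hd
    refine ⟨fun i hi => ?_, fun i hi => ?_, fun i hi => ?_⟩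
    · obtain ⟨i, rfl⟩ : ∃ j, i = j + 1 := ⟨i - 1, by omega⟩
      have := hd.left i (by omega)
      rw [(by omega : 2 * (i + 1) - 1 = 2 * i + 1), (by omega : 2 * (i + 1) + 1 = 2 * i + 2 + 1),
        hp _ _ (by omega), hp _ _ (by omega)]
      simpa using this
    · obtain ⟨i, rfl⟩ : ∃ j, i = j + 1 := ⟨i - 1, by omega⟩
      have := hd.arc i (by omega)
      rw [(by omega : 2 * (i + 1) - 1 = 2 * i + 1), (by omega : 2 * (i + 1) = 2 * i + 1 + 1),
        hp _ _ (by omega), hp _ _ (by omega)]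
      simpa using this
    · obtain ⟨i, rfl⟩ : ∃ j, i = j + 1 := ⟨i - 1, by omega⟩
      have := hd.free i (by omega) (by omega)
      rw [hp _ _ (by omega), hp _ _ (by omega)]
      simpa using this

end ArcSets

section ArcSetRecursion

variable {n k f : ℕ}

theorem IsArcWord.of_add_two {e e' : ℕ → ℕ} (h : IsArcWord n (k + 2) f e')
    (hfix : ∀ i ≤ k, e i = i) (hgt : ∀ x, k < x → k < e x)
    (hm : ∀ x y, k + 2 ≤ x → k + 2 ≤ y → e' x < e' y → e x < e y) :
    IsArcWord n k (f + 1) e where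
  fix i hi := hfix i hi.le
  left i hi := by
    rcases i with _ | i
    · simpa [hfix k le_rfl] using hgt (k + 2) (by omega)
    · rw [(by ring : k + 2 * (i + 1) = k + 2 + 2 * i)]
      exact hm _ _ (by omega) (by omega) (h.left i (by omega))
  arc i hi := by
    rcases i with _ | i
    · simpa [hfix k le_rfl] using hgt (k + 1) (by omega)
    · rw [(by ring : k + 2 * (i + 1) = k + 2 + 2 * i)]
      exact hm _ _ (by omega) (by omega) (h.arc i (by omega))
  free i hi hi' := hm _ _ (by omega) (by omega) (h.free i (by omega) hi')

theorem IsArcWord.to_add_two {e e' : ℕ → ℕ} (h : IsArcWord n k (f + 1) e)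
    (hfix : ∀ i < k + 2, e' i = i)
    (hm : ∀ x y, k + 2 ≤ x → k + 2 ≤ y → e x < e y → e' x < e' y) :
    IsArcWord n (k + 2) f e' where
  fix := hfix
  left i hi := by
    refine hm _ _ (by omega) (by omega) ?_
    rw [(by ring : k + 2 + 2 * i = k + 2 * (i + 1))]
    exact h.left (i + 1) (by omega)
  arc i hi := by
    refine hm _ _ (by omega) (by omega) ?_
    rw [(by ring : k + 2 + 2 * i = k + 2 * (i + 1))]
    exact h.arc (i + 1) (by omega)
  free i hi hi' := hm _ _ (by omega) (by omega) (h.free i (by omega) hi')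

theorem mul_cyc_mem_arcSet {d : Equiv.Perm (Fin n)} {j : ℕ} (hd : d ∈ arcSet n (k + 2) f)
    (hj : k + 1 + j < n) : d * cyc n (k + 1) j ∈ arcSet n k (f + 1) ∧
      (∀ i ≤ k, ev (d * cyc n (k + 1) j)⁻¹ i = i) ∧
      ev (d * cyc n (k + 1) j)⁻¹ (k + 1) = k + 1 + j := by
  rw [mem_arcSet] at hd
  have he : ∀ x, ev (d * cyc n (k + 1) j)⁻¹ x = if ev d⁻¹ x = k + 1 then k + 1 + j else
      if k + 1 < ev d⁻¹ x ∧ ev d⁻¹ x ≤ k + 1 + j then ev d⁻¹ x - 1 else ev d⁻¹ x := fun x => by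
    rw [mul_inv_rev, ev_mul, ev_cyc_inv hj]
  have hge : ∀ x, k + 2 ≤ x → k + 2 ≤ ev d⁻¹ x := fun x hx => le_ev_of_fix hd.fix hx
  have hfix : ∀ i ≤ k, ev (d * cyc n (k + 1) j)⁻¹ i = i := fun i hi => by
    rw [he, hd.fix i (by omega)]
    split_ifs <;> omega
  have hk : ev (d * cyc n (k + 1) j)⁻¹ (k + 1) = k + 1 + j := by
    rw [he, hd.fix _ (by omega), if_pos rfl]
  refine ⟨mem_arcSet.2 (hd.of_add_two hfix (fun x hx => ?_) fun x y hx hy hxy => ?_), hfix, hk⟩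
  · rcases (by omega : x = k + 1 ∨ k + 2 ≤ x) with rfl | hx
    · omega
    · have := hge x hx
      rw [he]
      split_ifs <;> omega
  · have := hge x hx
    have := hge y hy
    rw [he, he]
    split_ifs <;> omega

theorem mul_cyc_inv_mem_arcSet {d : Equiv.Perm (Fin n)} {j : ℕ} (hd : d ∈ arcSet n k (f + 1))
    (hk : ev d⁻¹ k = k) (hj : ev d⁻¹ (k + 1) = k + 1 + j) (hjn : k + 1 + j < n) :
    d * (cyc n (k + 1) j)⁻¹ ∈ arcSet n (k + 2) f := by
  rw [mem_arcSet] at hd ⊢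
  have he : ∀ x, ev (d * (cyc n (k + 1) j)⁻¹)⁻¹ x = if ev d⁻¹ x = k + 1 + j then k + 1 else
      if k + 1 ≤ ev d⁻¹ x ∧ ev d⁻¹ x < k + 1 + j then ev d⁻¹ x + 1 else ev d⁻¹ x := fun x => by
    rw [mul_inv_rev, inv_inv, ev_mul, ev_cyc hjn]
  refine hd.to_add_two (fun i hi => ?_) fun x y hx hy hxy => ?_
  · rcases (by omega : i < k ∨ i = k ∨ i = k + 1) with h | rfl | rfl
    · rw [he, hd.fix i h]
      split_ifs <;> omega
    · rw [he, hk]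
      split_ifs <;> omega
    · rw [he, hj, if_pos rfl]
  · have hne : ∀ z, k + 2 ≤ z → ev d⁻¹ z ≠ k + 1 + j := fun z hz => by
      rw [← hj, Ne, ev_inj]
      omega
    have := hne x hx
    have := hne y hy
    rw [he, he]
    split_ifs <;> omega

theorem IsArcWord.eq_of_ne {d : Equiv.Perm (Fin n)} (hd : IsArcWord n k (f + 1) (ev d))
    (hkn : k < n) (hk : ev d k ≠ k) : k + 2 * f + 2 < n ∧ ev d (k + 2 * f + 2) = k := by
  obtain ⟨x, hx⟩ : ∃ x, ev d x = k := ⟨ev d⁻¹ k, ev_ev_inv d k⟩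
  have hxn : x < n := by rwa [← ev_lt_iff d, hx]
  have hge : ∀ y, k ≤ y → k ≤ ev d y := fun y hy => le_ev_of_fix hd.fix hy
  have hxk : k < x := by
    by_contra h
    rcases (by omega : x = k ∨ x < k) with rfl | h
    · exact hk hx
    · have := hd.fix x h
      omega
  rcases lt_trichotomy x (k + 2 * f + 2) with h | rfl | h
  · exfalso
    obtain ⟨i, hi | hi⟩ : ∃ i, x = k + 2 * i + 2 ∨ x = k + 2 * i + 1 := ⟨(x - k - 1) / 2, by omega⟩
    · have := hd.left i (by omega)
      have := hge (k + 2 * i) (by omega)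
      rw [← hi, hx] at *
      omega
    · have := hd.arc i (by omega)
      have := hge (k + 2 * i) (by omega)
      rw [← hi, hx] at *
      omega
  · exact ⟨hxn, hx⟩
  · exfalso
    obtain ⟨y, rfl⟩ : ∃ y, x = y + 1 := ⟨x - 1, by omega⟩
    have := hd.free y (by omega) (by omega)
    have := hge y (by omega)
    omega

theorem cyc_inv_mul_mem_arcSet {d : Equiv.Perm (Fin n)} (hd : d ∈ arcSet n (k + 1) (f + 1))
    (hn : k + 2 * f + 2 < n) : (cyc n k (2 * f + 2))⁻¹ * d ∈ arcSet n k (f + 1) ∧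
      ev ((cyc n k (2 * f + 2))⁻¹ * d)⁻¹ k ≠ k := by
  rw [mem_arcSet] at hd ⊢
  have he : ∀ x, ev ((cyc n k (2 * f + 2))⁻¹ * d)⁻¹ x = ev d⁻¹ (if x = k + (2 * f + 2) then k else
      if k ≤ x ∧ x < k + (2 * f + 2) then x + 1 else x) := fun x => by
    rw [mul_inv_rev, inv_inv, ev_mul, ev_cyc (by omega)]
  have hge : ∀ x, k + 1 ≤ x → k + 1 ≤ ev d⁻¹ x := fun x hx => le_ev_of_fix hd.fix hx
  have hk : ev d⁻¹ k = k := hd.fix k (by omega)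
  refine ⟨⟨fun i hi => ?_, fun i hi => ?_, fun i hi => ?_, fun i hi hi' => ?_⟩, ?_⟩
  · rw [he, if_neg (by omega), if_neg (by omega), hd.fix i (by omega)]
  · rw [he, he, if_neg (by omega), if_pos (by omega), if_neg (by omega), if_pos (by omega)]
    have := hd.left i hi
    rwa [(by ring : k + 1 + 2 * i = k + 2 * i + 1)] at this
  · rw [he, he, if_neg (by omega), if_pos (by omega), if_neg (by omega), if_pos (by omega)]
    have := hd.arc i hi
    rwa [(by ring : k + 1 + 2 * i = k + 2 * i + 1)] at this
  · rw [he, he, if_neg (by omega : i + 1 ≠ _), if_neg (by omega : ¬ (k ≤ i + 1 ∧ _))]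
    rcases (by omega : i = k + (2 * f + 2) ∨ k + (2 * f + 2) < i) with rfl | h
    · rw [if_pos rfl, hk]
      exact hge _ (by omega)
    · rw [if_neg (by omega), if_neg (by omega)]
      exact hd.free i (by omega) hi'
  · rw [he, if_neg (by omega), if_pos (by omega)]
    have := hge (k + 1) le_rfl
    omega

theorem cyc_mul_mem_arcSet {d : Equiv.Perm (Fin n)} (hd : d ∈ arcSet n k (f + 1))
    (hk : ev d⁻¹ k ≠ k) (hn : k + 2 * f + 2 < n) :
    cyc n k (2 * f + 2) * d ∈ arcSet n (k + 1) (f + 1) := by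
  rw [mem_arcSet] at hd ⊢
  have hp := (hd.eq_of_ne (by omega) hk).2
  have he : ∀ x, ev (cyc n k (2 * f + 2) * d)⁻¹ x = ev d⁻¹ (if x = k then k + (2 * f + 2) else
      if k < x ∧ x ≤ k + (2 * f + 2) then x - 1 else x) := fun x => by
    rw [mul_inv_rev, ev_mul, ev_cyc_inv (by omega)]
  refine ⟨fun i hi => ?_, fun i hi => ?_, fun i hi => ?_, fun i hi hi' => ?_⟩
  · rcases (by omega : i < k ∨ i = k) with h | rfl
    · rw [he, if_neg (by omega), if_neg (by omega), hd.fix i h]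
    · rw [he, if_pos rfl, ← Nat.add_assoc, hp]
  · rw [he, he, if_neg (by omega), if_pos (by omega), if_neg (by omega), if_pos (by omega)]
    have := hd.left i hi
    rwa [(by omega : k + 1 + 2 * i - 1 = k + 2 * i),
      (by omega : k + 1 + 2 * i + 2 - 1 = k + 2 * i + 2)]
  · rw [he, he, if_neg (by omega), if_pos (by omega), if_neg (by omega), if_pos (by omega)]
    have := hd.arc i hi
    rwa [(by omega : k + 1 + 2 * i - 1 = k + 2 * i),
      (by omega : k + 1 + 2 * i + 1 - 1 = k + 2 * i + 1)]
  · rw [he, he, if_neg (by omega), if_neg (by omega), if_neg (by omega), if_neg (by omega)]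
    exact hd.free i (by omega) hi'

end ArcSetRecursion

section Shift

variable {k m f : ℕ}

theorem ev_shiftEmb (w : Equiv.Perm (Fin m)) (x : ℕ) :
    ev (shiftEmb (k + m) k m w) x = if x < k then x else k + ev w (x - k) := by
  classical
  rw [shiftEmb, dif_pos le_rfl]
  by_cases hx : x < k + m
  · rw [ev_of_lt _ hx]
    by_cases hk : x < k
    · rw [if_pos hk, Equiv.Perm.extendDomain_apply_not_subtype]
      simp only [not_and]
      omega
    · rw [if_neg hk, Equiv.Perm.extendDomain_apply_subtype _ _ ⟨not_lt.1 hk, hx⟩,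
        ev_of_lt _ (by omega)]
      rfl
  · rw [ev_of_le _ (by omega), ev_of_le _ (by omega), if_neg (by omega)]
    omega

theorem shiftEmb_inv (w : Equiv.Perm (Fin m)) :
    (shiftEmb (k + m) k m w)⁻¹ = shiftEmb (k + m) k m w⁻¹ := by
  rw [inv_eq_iff_mul_eq_one]
  refine ev_ext fun x _ => ?_
  rw [ev_mul, ev_shiftEmb, ev_shiftEmb, ev_one]
  split_ifs with h1 h2
  · rfl
  · omega
  · rw [Nat.add_sub_cancel_left, ev_ev_inv]
    omega

theorem exists_shiftEmb_eq {d : Equiv.Perm (Fin (k + m))} (h : ∀ i < k, ev d i = i) :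
    ∃ w, shiftEmb (k + m) k m w = d := by
  have h' : ∀ i < k, ev d⁻¹ i = i := fun i hi => by rw [← ev_inj d, ev_ev_inv, h i hi]
  have hlt : ∀ (u : Equiv.Perm (Fin (k + m))), (∀ i < k, ev u i = i) → ∀ y < m,
      k ≤ ev u (k + y) ∧ ev u (k + y) < k + m := fun u hu y hy =>
    ⟨le_ev_of_fix hu (by omega), (ev_lt_iff u).2 (by omega)⟩
  refine ⟨⟨fun y => ⟨ev d (k + y) - k, by have := hlt d h y y.2; omega⟩,
    fun y => ⟨ev d⁻¹ (k + y) - k, by have := hlt d⁻¹ h' y y.2; omega⟩,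
    fun y => Fin.ext ?_, fun y => Fin.ext ?_⟩, ev_ext fun x hx => ?_⟩
  · have := hlt d h y y.2
    simp [Nat.add_sub_cancel' this.1]
  · have := hlt d⁻¹ h' y y.2
    simp [Nat.add_sub_cancel' this.1]
  · rw [ev_shiftEmb]
    split_ifs with hk
    · exact (h x hk).symm
    · have := hlt d h (x - k) (by omega)
      rw [ev_of_lt _ (by omega)]
      simp only [Equiv.coe_fn_mk]
      rw [Nat.add_sub_cancel' this.1]
      congr 1
      omega

open scoped Classical in
theorem image_shiftEmb_arcSet :
    (arcSet m 0 f).image (shiftEmb (k + m) k m) = arcSet (k + m) k f := by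
  have key : ∀ w : Equiv.Perm (Fin m),
      w ∈ arcSet m 0 f ↔ shiftEmb (k + m) k m w ∈ arcSet (k + m) k f := by
    intro w
    have he : ∀ x, ev (shiftEmb (k + m) k m w)⁻¹ (k + x) = k + ev w⁻¹ x := fun x => by
      rw [shiftEmb_inv, ev_shiftEmb, if_neg (by omega), Nat.add_sub_cancel_left]
    rw [mem_arcSet, mem_arcSet]
    constructor
    · intro h
      refine ⟨fun i hi => ?_, fun i hi => ?_, fun i hi => ?_, fun i hi hi' => ?_⟩
      · rw [shiftEmb_inv, ev_shiftEmb, if_pos hi]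
      · have := h.left i hi
        simp only [Nat.add_assoc, he, zero_add] at this ⊢
        omega
      · have := h.arc i hi
        simp only [Nat.add_assoc, he, zero_add] at this ⊢
        omega
      · obtain ⟨i, rfl⟩ : ∃ j, i = k + j := ⟨i - k, by omega⟩
        have := h.free i (by omega) (by omega)
        simp only [Nat.add_assoc, he] at this ⊢
        omega
    · intro h
      refine ⟨by simp, fun i hi => ?_, fun i hi => ?_, fun i hi hi' => ?_⟩
      · have := h.left i hi
        simp only [Nat.add_assoc, he, zero_add] at this ⊢
        omega
      · have := h.arc i hi
        simp only [Nat.add_assoc, he, zero_add] at this ⊢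
        omega
      · have := h.free (k + i) (by omega) (by omega)
        simp only [Nat.add_assoc, he] at this
        omega
  ext d
  rw [mem_image]
  constructor
  · rintro ⟨w, hw, rfl⟩
    exact (key w).1 hw
  · intro hd
    obtain ⟨w, rfl⟩ := exists_shiftEmb_eq (d := d) fun i hi => by
      rw [← ev_inj d⁻¹, ev_inv_ev, (mem_arcSet.1 hd).fix i hi]
    exact ⟨w, (key w).2 hd, rfl⟩

end Shift

section HatArcSet

variable {F : Type*} [Field F] {A : Type*} [Ring A] [Algebra F A] {n : ℕ} {q r : F}

namespace BMWData

variable (D : BMWData F A n q r)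

open scoped Classical in
theorem hat_arcSet_filter_eq {f k m : ℕ} (h : k + m + 2 = n) :
    hat q D.Tw ((arcSet n k (f + 1)).filter fun d => ev d⁻¹ k = k) =
      hat q D.Tw (arcSet n (k + 2) f) * D.ascSum m (k + 2) := by
  rw [D.ascSum_eq_sum (k := k + 1) (by omega), hat, hat, sum_mul_sum, ← sum_product']
  have hpos : ∀ {d}, d ∈ arcSet n k (f + 1) → ev d⁻¹ k = k →
      ∃ j < m + 1, ev d⁻¹ (k + 1) = k + 1 + j := by
    intro d hd hk
    have h1 := (mem_arcSet.1 hd).arc 0 (by omega)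
    have h2 := (ev_lt_iff d⁻¹ (x := k + 1)).2 (by omega)
    simp only [mul_zero, add_zero, hk] at h1
    exact ⟨ev d⁻¹ (k + 1) - (k + 1), by omega, by omega⟩
  refine sum_nbij' (fun d => (d * (cyc n (k + 1) (ev d⁻¹ (k + 1) - (k + 1)))⁻¹,
    ev d⁻¹ (k + 1) - (k + 1))) (fun p => p.1 * cyc n (k + 1) p.2) ?_ ?_ ?_ ?_ ?_
  · intro d hd
    obtain ⟨hd, hk⟩ := mem_filter.1 hd
    obtain ⟨j, hj, hj'⟩ := hpos hd hk
    rw [hj', Nat.add_sub_cancel_left, mem_product, mem_range]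
    exact ⟨mul_cyc_inv_mem_arcSet hd hk hj' (by omega), hj⟩
  · rintro ⟨d, j⟩ hd
    rw [mem_product, mem_range] at hd
    have := mul_cyc_mem_arcSet hd.1 (by omega : k + 1 + j < n)
    exact mem_filter.2 ⟨this.1, this.2.1 k le_rfl⟩
  · intro d _
    simp
  · rintro ⟨d, j⟩ hd
    rw [mem_product, mem_range] at hd
    have := (mul_cyc_mem_arcSet hd.1 (by omega : k + 1 + j < n)).2.2
    simp only [this, Nat.add_sub_cancel_left, mul_inv_cancel_right]
  · intro d hd
    obtain ⟨hd, hk⟩ := mem_filter.1 hd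
    obtain ⟨j, hj, hj'⟩ := hpos hd hk
    have hd' := mem_arcSet.1 (mul_cyc_inv_mem_arcSet hd hk hj' (by omega))
    simp only [hj', Nat.add_sub_cancel_left]
    obtain ⟨u, rfl⟩ : ∃ u, d = u * cyc n (k + 1) j :=
      ⟨d * (cyc n (k + 1) j)⁻¹, by simp⟩
    rw [mul_inv_cancel_right] at hd' ⊢
    have hfix : ∀ i < k + 2, ev u i = i := fun i hi => by
      rw [← ev_inj u⁻¹, ev_inv_ev, hd'.fix i hi]
    have hl : len (u * cyc n (k + 1) j) = len u + j := by
      refine len_mul_cyc u (by omega) fun y h1 h2 => ?_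
      rw [hfix (k + 1) (by omega)]
      exact le_ev_of_fix hfix (by omega)
    rw [D.Tw_mul _ _ (by rw [hl, len_cyc (by omega)]), hl, smul_mul_smul_comm, pow_add]

open scoped Classical in
theorem hat_arcSet_filter_ne {f k : ℕ} (h : k + 2 * f + 2 < n) :
    hat q D.Tw ((arcSet n k (f + 1)).filter fun d => ¬ ev d⁻¹ k = k) =
      q ^ (2 * f + 2) • (D.descProd k (2 * f + 2) * hat q D.Tw (arcSet n (k + 1) (f + 1))) := by
  rw [D.descProd_eq (by omega), hat, hat, mul_sum, smul_sum]
  refine sum_nbij' (cyc n k (2 * f + 2) * ·) ((cyc n k (2 * f + 2))⁻¹ * ·) ?_ ?_ ?_ ?_ ?_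
  · intro d hd
    obtain ⟨hd, hk⟩ := mem_filter.1 hd
    exact cyc_mul_mem_arcSet hd hk h
  · intro d hd
    exact mem_filter.2 (cyc_inv_mul_mem_arcSet hd h)
  · intro d _
    simp
  · intro d _
    simp
  · intro d hd
    obtain ⟨hd, hk⟩ := mem_filter.1 hd
    have hd' := mem_arcSet.1 (cyc_mul_mem_arcSet hd hk h)
    obtain ⟨u, rfl⟩ : ∃ u, d = (cyc n k (2 * f + 2))⁻¹ * u :=
      ⟨cyc n k (2 * f + 2) * d, by simp⟩
    rw [mul_inv_cancel_left] at hd' ⊢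
    have hl : len ((cyc n k (2 * f + 2))⁻¹ * u) = 2 * f + 2 + len u := by
      rw [← len_inv, mul_inv_rev, inv_inv, len_mul_cyc _ (by omega), len_inv, add_comm]
      intro y h1 h2
      rw [hd'.fix k (by omega)]
      exact le_ev_of_fix hd'.fix h1
    rw [D.Tw_mul _ _ (by rw [hl, len_inv, len_cyc (by omega)]), hl, mul_smul_comm, smul_smul,
      pow_add]

theorem hat_arcSet {m f k : ℕ} (h : k + m = n) (hf : 2 * f ≤ m) :
    hat q D.Tw (arcSet n k f) = D.arcSum m f k := by
  classical
  induction m using Nat.strong_induction_on generalizing f k with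
  | _ m ih =>
  cases f with
  | zero => simp [arcSet_zero, hat, D.Tw_one]
  | succ f =>
    obtain ⟨m, rfl⟩ : ∃ m', m = m' + 2 := ⟨m - 2, by omega⟩
    have hsplit : hat q D.Tw (arcSet n k (f + 1)) =
        hat q D.Tw ((arcSet n k (f + 1)).filter fun d => ev d⁻¹ k = k) +
        hat q D.Tw ((arcSet n k (f + 1)).filter fun d => ¬ ev d⁻¹ k = k) :=
      (sum_filter_add_sum_filter_not _ _ _).symm
    rw [hsplit, D.hat_arcSet_filter_eq (by omega : k + m + 2 = n), arcSum_succ,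
      ih m (by omega) (by omega) (by omega)]
    congr 1
    rcases (by omega : 2 * f + 2 = m + 2 ∨ 2 * f + 2 ≤ m + 1) with hm | hm
    · rw [arcSum_eq_zero _ _ (by omega : m + 1 < 2 * (f + 1)), mul_zero, smul_zero,
        filter_false_of_mem]
      · simp [hat]
      · intro d hd hk
        have := ((mem_arcSet.1 hd).eq_of_ne (by omega) hk).1
        omega
    · rw [D.hat_arcSet_filter_ne (by omega), ih (m + 1) (by omega) (by omega) (by omega)]

theorem hat_Hset {f : ℕ} (h : 2 * f ≤ n) : hat q D.Tw (Hset n f) = D.arcSum n f 0 := by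
  rw [Hset_eq_arcSet h, D.hat_arcSet (zero_add n) h]

open scoped Classical in
theorem hat_image_shiftEmb_Hset {f m : ℕ} (h : m + 2 = n) (hf : 2 * f ≤ m) :
    hat q D.Tw ((Hset m f).image (shiftEmb n 2 m)) = D.arcSum m f 2 := by
  obtain rfl : n = 2 + m := by omega
  rw [Hset_eq_arcSet hf, image_shiftEmb_arcSet, D.hat_arcSet rfl hf]

end BMWData

end HatArcSet

/-- With `y_f = Ŝ_n · Ê_f · Ĥ_f`: `y_0 E_1 = Ŝ_n E_1`, and for
`1 ≤ f ≤ ⌊n/2⌋`,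
`y_f E_1 = ((rq^{2n-2f-2} - q⁻¹)(1 + qr⁻¹)/(q - q⁻¹)) · Ŝ_n Ê_f Ĥ_{f-1}^{{3,…,n}}
 + q^{2f} · Ŝ_n Ê_{f+1} Ĥ_f^{{3,…,n}}`, the second summand being `0` if `2f+2 > n`. -/
theorem statement17 {F : Type*} [Field F] {A : Type*} [Ring A] [Algebra F A]
    {n : ℕ} (hn : 1 ≤ n) {q r : F} (D : BMWData F A n q r) :
    (hat q D.Tw (Finset.univ : Finset (Equiv.Perm (Fin n))) * Ehat D.E 0 *
        hat q D.Tw (Hset n 0) * D.E 1 =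
      hat q D.Tw (Finset.univ : Finset (Equiv.Perm (Fin n))) * D.E 1) ∧
    (∀ f, 1 ≤ f → 2 * f ≤ n →
      hat q D.Tw (Finset.univ : Finset (Equiv.Perm (Fin n))) * Ehat D.E f *
          hat q D.Tw (Hset n f) * D.E 1 =
        ((r * q ^ (2 * (n : ℤ) - 2 * (f : ℤ) - 2) - q⁻¹) * (1 + q * r⁻¹) / (q - q⁻¹)) •
          (hat q D.Tw (Finset.univ : Finset (Equiv.Perm (Fin n))) * Ehat D.E f *
            hat q D.Tw ((Hset (n - 2) (f - 1)).image (shiftEmb n 2 (n - 2)))) +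
        (if 2 * f + 2 ≤ n then
          q ^ (2 * f) •
            (hat q D.Tw (Finset.univ : Finset (Equiv.Perm (Fin n))) * Ehat D.E (f + 1) *
              hat q D.Tw ((Hset (n - 2) f).image (shiftEmb n 2 (n - 2))))
         else 0)) := by
  refine ⟨?_, fun f hf hfn => ?_⟩
  · rw [D.hat_Hset (by omega), BMWData.arcSum_zero, mul_one, ← D.cupProd_eq_Ehat,
      BMWData.cupProd_zero, mul_one]
  · obtain ⟨g, rfl⟩ : ∃ g, f = g + 1 := ⟨f - 1, by omega⟩
    obtain ⟨p, rfl⟩ : ∃ p, n = 2 * g + p + 2 := ⟨n - (2 * g + 2), by omega⟩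
    have h := D.absorbs_hat_univ.mul_cupProd_arcSum_E g p rfl
    have hexp : q ^ (2 * ((2 * g + p + 2 : ℕ) : ℤ) - 2 * ((g + 1 : ℕ) : ℤ) - 2) =
        q ^ (2 * (g + p)) := by
      rw [← zpow_natCast]
      congr 1
      push_cast
      ring
    rw [hexp, Nat.add_sub_cancel, Nat.add_sub_cancel, ← D.cupProd_eq_Ehat, ← D.cupProd_eq_Ehat,
      D.hat_Hset hfn]
    have e1 := D.hat_image_shiftEmb_Hset (f := g) (m := 2 * g + p) rfl (by omega)
    simp only [mul_assoc] at h ⊢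
    rw [e1, h]
    congr 1
    split_ifs with hp
    · have e2 := D.hat_image_shiftEmb_Hset (f := g + 1) (m := 2 * g + p) rfl (by omega)
      rw [e2]
      rfl
    · rw [BMWData.arcSum_eq_zero _ _ (by omega : 2 * g + p < 2 * (g + 1)), mul_zero, mul_zero,
        smul_zero]

end BMWPaper
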